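/- arXiv:2401.16113 — 7 statements merged into one kernel-verified Lean document; each statement's English description precedes it below -/
import Mathlib

section
/- (Conditioning of the all-at-once matrix.) Let A be an N×N real matrix that is negative semi-definite, let M ≥ 1, τ > 0, T = Mτ, and let 𝓜 = B₁ ⊗ I_N − B₂ ⊗ (τA). Then 𝓜 is invertible, ‖𝓜‖₂ ≤ 2 + τ‖A‖₂, ‖𝓜 z‖₂ ≥ (1/M)‖z‖₂ for every z ∈ ℝ^{MN}, and consequently the spectral condition number satisfies ‖𝓜‖₂‖𝓜⁻¹‖₂ ≤ 2M + T‖A‖₂. -/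
open Matrix Kronecker Polynomial

/-- Euclidean (ℓ²) norm of a real vector. -/
noncomputable def vNorm {n : Type*} [Fintype n] (y : n → ℝ) : ℝ :=
  ‖(EuclideanSpace.equiv n ℝ).symm y‖

/-- Spectral norm (ℓ²-operator norm) of a real matrix. -/
noncomputable def sNorm {n : Type*} [Fintype n] [DecidableEq n] (A : Matrix n n ℝ) : ℝ :=
  ‖Matrix.toEuclideanCLM (𝕜 := ℝ) A‖

/-- `B₁`: M×M lower bidiagonal Toeplitz matrix, 1 on diagonal, −1 on first subdiagonal. -/
noncomputable def B1 (M : ℕ) : Matrix (Fin M) (Fin M) ℝ :=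
  Matrix.of fun i j => if (i : ℕ) = (j : ℕ) then 1 else if (i : ℕ) = (j : ℕ) + 1 then -1 else 0

/-- `B₂`: M×M lower bidiagonal Toeplitz matrix, 1/2 on diagonal and on first subdiagonal. -/
noncomputable def B2 (M : ℕ) : Matrix (Fin M) (Fin M) ℝ :=
  Matrix.of fun i j => if (i : ℕ) = (j : ℕ) then 1/2 else if (i : ℕ) = (j : ℕ) + 1 then 1/2 else 0

/-- `C₁^{(α)}`: B₁ with the additional entry −α in position (1, M). -/
noncomputable def C1 (M : ℕ) (α : ℝ) : Matrix (Fin M) (Fin M) ℝ :=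
  Matrix.of fun i j => B1 M i j + (if (i : ℕ) = 0 ∧ (j : ℕ) = M - 1 then -α else 0)

/-- `C₂^{(α)}`: B₂ with the additional entry α/2 in position (1, M). -/
noncomputable def C2 (M : ℕ) (α : ℝ) : Matrix (Fin M) (Fin M) ℝ :=
  Matrix.of fun i j => B2 M i j + (if (i : ℕ) = 0 ∧ (j : ℕ) = M - 1 then α/2 else 0)

lemma aux_lower {E : Type*} [NormedAddCommGroup E] [InnerProductSpace ℝ E] (L : E →L[ℝ] E)
    (hL : ∀ y, inner ℝ y (L y) ≤ 0) (τ : ℝ) (hτ : 0 < τ) (w r : ℕ → E) (h0 : w 0 = 0) (M : ℕ)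
    (hr : ∀ n < M, r n = w (n+1) - w n - (τ/2) • L (w (n+1) + w n)) :
    ∑ n ∈ Finset.range M, ‖w (n+1)‖^2 ≤ (M:ℝ)^2 * ∑ n ∈ Finset.range M, ‖r n‖^2 := by
  have step : ∀ n < M, ‖w (n+1)‖ ≤ ‖w n‖ + ‖r n‖ := by
    intro n hn
    have e : inner ℝ (w (n+1) + w n) (r n) = ‖w (n+1)‖^2 - ‖w n‖^2
        - (τ/2) * inner ℝ (w (n+1) + w n) (L (w (n+1) + w n)) := by
      rw [hr n hn, inner_sub_right, inner_smul_right, inner_sub_right, inner_add_left,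
        inner_add_left, real_inner_self_eq_norm_sq, real_inner_self_eq_norm_sq,
        real_inner_comm (w n) (w (n+1))]
      ring
    have h1 := hL (w (n+1) + w n)
    have h2 := real_inner_le_norm (w (n+1) + w n) (r n)
    have h3 := norm_add_le (w (n+1)) (w n)
    have h4 : ‖w (n+1) + w n‖ * ‖r n‖ ≤ (‖w (n+1)‖ + ‖w n‖) * ‖r n‖ := by gcongr
    have h5 : (τ/2) * inner ℝ (w (n+1) + w n) (L (w (n+1) + w n)) ≤ 0 :=
      mul_nonpos_of_nonneg_of_nonpos (by positivity) h1
    by_contra! hc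
    have hp : 0 < ‖w (n+1)‖ := lt_of_le_of_lt (by positivity) hc
    have := norm_nonneg (w n)
    nlinarith
  have tot : ∀ n ≤ M, ‖w n‖ ≤ ∑ k ∈ Finset.range n, ‖r k‖ := by
    intro n
    induction n with
    | zero => simp [h0]
    | succ n ih =>
      intro hn
      rw [Finset.sum_range_succ]
      linarith [ih (by omega), step n (by omega)]
  have each : ∀ n ∈ Finset.range M, ‖w (n+1)‖^2 ≤ M * ∑ k ∈ Finset.range M, ‖r k‖^2 := by
    intro n hn
    have hn' := Finset.mem_range.1 hn
    have h1 : ‖w (n+1)‖ ≤ ∑ k ∈ Finset.range M, ‖r k‖ :=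
      (tot (n+1) hn').trans (Finset.sum_le_sum_of_subset_of_nonneg
        (Finset.range_mono hn') (fun _ _ _ => norm_nonneg _))
    calc ‖w (n+1)‖^2 ≤ (∑ k ∈ Finset.range M, ‖r k‖)^2 := by gcongr
      _ ≤ _ := by simpa using sq_sum_le_card_mul_sum_sq (s := Finset.range M) (f := fun k => ‖r k‖)
  calc _ ≤ ∑ n ∈ Finset.range M, M * ∑ k ∈ Finset.range M, ‖r k‖^2 := Finset.sum_le_sum each
    _ = _ := by rw [Finset.sum_const, Finset.card_range, nsmul_eq_mul]; ring

lemma aux_upper {E : Type*} [NormedAddCommGroup E] [InnerProductSpace ℝ E] (L : E →L[ℝ] E)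
    (τ : ℝ) (hτ : 0 < τ) (w r : ℕ → E) (h0 : w 0 = 0) (M : ℕ)
    (hr : ∀ n < M, r n = w (n+1) - w n - (τ/2) • L (w (n+1) + w n)) :
    ∑ n ∈ Finset.range M, ‖r n‖^2 ≤ (2 + τ * ‖L‖)^2 * ∑ n ∈ Finset.range M, ‖w (n+1)‖^2 := by
  have each : ∀ n ∈ Finset.range M, ‖r n‖^2 ≤
      (2 + τ * ‖L‖)^2 / 2 * (‖w (n+1)‖^2 + ‖w n‖^2) := by
    intro n hn
    have h1 : ‖r n‖ ≤ (1 + τ / 2 * ‖L‖) * (‖w (n+1)‖ + ‖w n‖) := by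
      rw [hr n (Finset.mem_range.1 hn)]
      have a1 := norm_sub_le (w (n+1) - w n) ((τ/2) • L (w (n+1) + w n))
      have a2 := norm_sub_le (w (n+1)) (w n)
      have a3 : ‖(τ/2) • L (w (n+1) + w n)‖ ≤ τ/2 * (‖L‖ * (‖w (n+1)‖ + ‖w n‖)) := by
        rw [norm_smul, Real.norm_of_nonneg (by positivity)]
        gcongr
        exact (L.le_opNorm _).trans (by gcongr; exact norm_add_le _ _)
      linarith
    have h2 : ‖r n‖^2 ≤ ((1 + τ / 2 * ‖L‖) * (‖w (n+1)‖ + ‖w n‖))^2 := by gcongr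
    have h3 := mul_nonneg (sq_nonneg (1 + τ / 2 * ‖L‖)) (sq_nonneg (‖w (n+1)‖ - ‖w n‖))
    nlinarith
  have hs : ∑ n ∈ Finset.range M, ‖w n‖^2 ≤ ∑ n ∈ Finset.range M, ‖w (n+1)‖^2 := by
    have a := Finset.sum_range_succ (fun n => ‖w n‖^2) M
    have b := Finset.sum_range_succ' (fun n => ‖w n‖^2) M
    simp only [h0, norm_zero] at b
    nlinarith [sq_nonneg ‖w M‖]
  calc _ ≤ _ := Finset.sum_le_sum each
    _ = (2 + τ * ‖L‖)^2 / 2 * (∑ n ∈ Finset.range M, ‖w (n+1)‖^2 + ∑ n ∈ Finset.range M, ‖w n‖^2) := by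
      rw [← Finset.mul_sum, Finset.sum_add_distrib]
    _ ≤ (2 + τ * ‖L‖)^2 / 2 * (∑ n ∈ Finset.range M, ‖w (n+1)‖^2 + ∑ n ∈ Finset.range M, ‖w (n+1)‖^2) := by
      gcongr
    _ = _ := by ring

/-- the block sequence, shifted by one, with value 0 at index 0 -/
noncomputable def blk {N M : ℕ} (z : Fin M × Fin N → ℝ) (n : ℕ) : EuclideanSpace ℝ (Fin N) :=
  if h : 1 ≤ n ∧ n - 1 < M then WithLp.toLp 2 (fun j => z (⟨n - 1, h.2⟩, j)) else 0

lemma blk_zero {N M : ℕ} (z : Fin M × Fin N → ℝ) : blk z 0 = 0 := by simp [blk]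

lemma blk_succ {N M : ℕ} (z : Fin M × Fin N → ℝ) (i : Fin M) (j : Fin N) :
    blk z (i + 1) j = z (i, j) := by
  simp [blk]

lemma vNorm_sq {N M : ℕ} (z : Fin M × Fin N → ℝ) :
    vNorm z ^ 2 = ∑ n ∈ Finset.range M, ‖blk z (n+1)‖^2 := by
  rw [Finset.sum_range (fun n => ‖blk z (n+1)‖^2), vNorm, EuclideanSpace.norm_sq_eq,
    Fintype.sum_prod_type]
  refine Finset.sum_congr rfl fun i _ => ?_
  rw [EuclideanSpace.norm_sq_eq]
  refine Finset.sum_congr rfl fun j _ => ?_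
  rw [blk_succ]
  simp

lemma bidiag {N M : ℕ} (z : Fin M × Fin N → ℝ) (a b : ℝ) (i : Fin M) (j : Fin N) :
    ∑ k : Fin M, (if (i : ℕ) = (k : ℕ) then a else if (i : ℕ) = (k : ℕ) + 1 then b else 0) * z (k, j)
      = a * blk z (i+1) j + b * blk z i j := by
  have h1 : ∀ k : Fin M, (if (i : ℕ) = (k : ℕ) then a else if (i : ℕ) = (k : ℕ) + 1 then b else 0) * z (k, j)
      = (if i = k then a * z (k, j) else 0) + (if (i : ℕ) = (k : ℕ) + 1 then b * z (k, j) else 0) := by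
    intro k
    by_cases h : i = k
    · subst h; simp
    · have : (i : ℕ) ≠ k := fun h' => h (Fin.ext h')
      simp [h, this]
  simp_rw [h1]
  rw [Finset.sum_add_distrib, Finset.sum_ite_eq, blk_succ]
  simp only [Finset.mem_univ, if_true]
  congr 1
  obtain ⟨i, hi⟩ := i
  cases i with
  | zero => simp [blk_zero]
  | succ n =>
    have h2 : ∀ k : Fin M, (n + 1 = (k : ℕ) + 1) ↔ (⟨n, by omega⟩ : Fin M) = k := by
      intro k; rw [Fin.ext_iff]; simp
    simp only [h2]
    rw [Finset.sum_ite_eq]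
    simp only [Finset.mem_univ, if_true]
    rw [← blk_succ z ⟨n, by omega⟩ j]

lemma blk_mul {N M : ℕ} (A : Matrix (Fin N) (Fin N) ℝ) (τ : ℝ) (z : Fin M × Fin N → ℝ)
    (n : ℕ) (hn : n < M) :
    blk ((B1 M ⊗ₖ (1 : Matrix (Fin N) (Fin N) ℝ) - B2 M ⊗ₖ (τ • A)).mulVec z) (n+1) =
      blk z (n+1) - blk z n
        - (τ/2) • Matrix.toEuclideanCLM (𝕜 := ℝ) A (blk z (n+1) + blk z n) := by
  ext j
  have := blk_succ ((B1 M ⊗ₖ (1 : Matrix (Fin N) (Fin N) ℝ) - B2 M ⊗ₖ (τ • A)).mulVec z) ⟨n, hn⟩ j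
  simp only at this
  rw [this, sub_mulVec, Pi.sub_apply]
  have e1 : ((B1 M ⊗ₖ (1 : Matrix (Fin N) (Fin N) ℝ)).mulVec z) (⟨n, hn⟩, j)
      = blk z (n+1) j - blk z n j := by
    have := bidiag z 1 (-1) ⟨n, hn⟩ j
    simp only at this
    rw [mulVec, dotProduct, Fintype.sum_prod_type, show blk z (n+1) j - blk z n j = 1 * blk z (n+1) j + -1 * blk z n j by ring, ← this]
    refine Finset.sum_congr rfl fun k _ => ?_
    simp [kroneckerMap_apply, Matrix.one_apply, B1]
  have e2 : ((B2 M ⊗ₖ (τ • A)).mulVec z) (⟨n, hn⟩, j)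
      = (τ/2) * ∑ l, A j l * (blk z (n+1) l + blk z n l) := by
    rw [mulVec, dotProduct, Fintype.sum_prod_type, Finset.sum_comm, Finset.mul_sum]
    refine Finset.sum_congr rfl fun l _ => ?_
    have := bidiag z (1/2) (1/2) ⟨n, hn⟩ l
    simp only at this
    rw [show τ / 2 * (A j l * (blk z (n+1) l + blk z n l)) = τ * A j l * (1/2 * blk z (n+1) l + 1/2 * blk z n l) by ring, ← this, Finset.mul_sum]
    refine Finset.sum_congr rfl fun k _ => ?_
    simp only [kroneckerMap_apply, B2, Matrix.of_apply, Matrix.smul_apply, smul_eq_mul]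
    ring
  rw [e1, e2]
  simp [Matrix.mulVec, dotProduct, Matrix.ofLp_toEuclideanCLM, mul_add, Finset.sum_add_distrib]

/-- Conditioning of the all-at-once matrix 𝓜 = B₁⊗I − B₂⊗(τA):
𝓜 is invertible, ‖𝓜‖₂ ≤ 2 + τ‖A‖₂, ‖𝓜z‖₂ ≥ (1/M)‖z‖₂, and
‖𝓜‖₂‖𝓜⁻¹‖₂ ≤ 2M + T‖A‖₂ with T = Mτ. -/
theorem stmt_4 {N M : ℕ} (hN : 1 ≤ N) (hM : 1 ≤ M)
    (A : Matrix (Fin N) (Fin N) ℝ) (hA : ∀ y : Fin N → ℝ, y ⬝ᵥ A.mulVec y ≤ 0)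
    (τ T : ℝ) (hτ : 0 < τ) (hT : T = (M : ℝ) * τ)
    (𝓜 : Matrix (Fin M × Fin N) (Fin M × Fin N) ℝ)
    (h𝓜 : 𝓜 = B1 M ⊗ₖ (1 : Matrix (Fin N) (Fin N) ℝ) - B2 M ⊗ₖ (τ • A)) :
    IsUnit 𝓜 ∧ sNorm 𝓜 ≤ 2 + τ * sNorm A ∧
    (∀ z : Fin M × Fin N → ℝ, (1 / (M : ℝ)) * vNorm z ≤ vNorm (𝓜.mulVec z)) ∧
    sNorm 𝓜 * sNorm 𝓜⁻¹ ≤ 2 * (M : ℝ) + T * sNorm A := by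
  have hMp : (0:ℝ) < M := by exact_mod_cast hM
  set L := Matrix.toEuclideanCLM (𝕜 := ℝ) A with hLdef
  have hL : ∀ y, inner ℝ y (L y) ≤ 0 := by
    intro y
    have := hA y.ofLp
    rw [PiLp.inner_apply]
    simpa [L, dotProduct, Matrix.ofLp_toEuclideanCLM, mul_comm] using this
  have hvn : ∀ z : Fin M × Fin N → ℝ, 0 ≤ vNorm z := fun z => norm_nonneg _
  have hlow : ∀ z : Fin M × Fin N → ℝ, vNorm z ≤ M * vNorm (𝓜.mulVec z) := by
    intro z
    have := aux_lower L hL τ hτ (blk z) (fun n => blk (𝓜.mulVec z) (n+1)) (blk_zero z) M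
      (fun n hn => by rw [h𝓜]; exact blk_mul A τ z n hn)
    rw [← vNorm_sq, ← vNorm_sq, ← mul_pow] at this
    exact (abs_le_of_sq_le_sq' this (mul_nonneg hMp.le (hvn _))).2
  have hup : ∀ z : Fin M × Fin N → ℝ, vNorm (𝓜.mulVec z) ≤ (2 + τ * sNorm A) * vNorm z := by
    intro z
    have := aux_upper L τ hτ (blk z) (fun n => blk (𝓜.mulVec z) (n+1)) (blk_zero z) M
      (fun n hn => by rw [h𝓜]; exact blk_mul A τ z n hn)
    rw [← vNorm_sq, ← vNorm_sq, ← mul_pow] at this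
    exact (abs_le_of_sq_le_sq' this (mul_nonneg (by positivity) (hvn _))).2
  have hsA : 0 ≤ sNorm A := norm_nonneg _
  have hunit : IsUnit 𝓜 := by
    rw [← Matrix.mulVec_injective_iff_isUnit]
    intro x y hxy
    have h1 := hlow (x - y)
    have h2 : 𝓜.mulVec (x - y) = 0 := by rw [mulVec_sub]; exact sub_eq_zero.2 hxy
    have h3 : vNorm (0 : Fin M × Fin N → ℝ) = 0 := by simp [vNorm]
    rw [h2, h3, mul_zero] at h1
    have h4 : vNorm (x - y) = 0 := le_antisymm h1 (hvn _)
    rw [vNorm, norm_eq_zero] at h4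
    exact sub_eq_zero.1 ((EuclideanSpace.equiv _ ℝ).symm.map_eq_zero_iff.1 h4)
  have hn1 : sNorm 𝓜 ≤ 2 + τ * sNorm A := by
    refine ContinuousLinearMap.opNorm_le_bound _ (by positivity) fun x => ?_
    exact hup x.ofLp
  have hn2 : sNorm 𝓜⁻¹ ≤ M := by
    refine ContinuousLinearMap.opNorm_le_bound _ hMp.le fun x => ?_
    have := hlow (𝓜⁻¹.mulVec x.ofLp)
    rw [mulVec_mulVec, Matrix.mul_nonsing_inv _ ((Matrix.isUnit_iff_isUnit_det _).1 hunit),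
      one_mulVec] at this
    exact this
  refine ⟨hunit, hn1, ?_, ?_⟩
  · intro z
    rw [one_div, inv_mul_le_iff₀ hMp]
    exact hlow z
  · calc sNorm 𝓜 * sNorm 𝓜⁻¹ ≤ (2 + τ * sNorm A) * M :=
        mul_le_mul hn1 hn2 (norm_nonneg _) (by positivity)
      _ = _ := by rw [hT]; ring
end

section
/- Let A be an N×N real matrix that is negative semi-definite, τ > 0, α ∈ (0,1), and M ≥ 1. With Q₁ = I − (τ/2)A, Q₂ = I + (τ/2)A, J_k = (Q₁⁻¹Q₂)ᵏ, 𝓜 = B₁ ⊗ I_N − B₂ ⊗ (τA) and P_α = C₁^{(α)} ⊗ I_N − C₂^{(α)} ⊗ (τA), one has the explicit identity 𝓜⁻¹ P_α = I_{MN} − α Σ_{k=1}^{M} E_{kM} ⊗ J_k, where E_{kM} is the M×M matrix with a single 1 in entry (k, M); i.e., 𝓜⁻¹P_α coincides with the identity except in its last block column, whose k-th block equals −αJ_k for k < M and I − αJ_M for k = M. -/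
open Matrix Kronecker Polynomial

/-- The M×M matrix with a single 1 in entry (k, M) (0-indexed: row k, column M−1). -/
noncomputable def Ek (M : ℕ) (k : Fin M) : Matrix (Fin M) (Fin M) ℝ :=
  Matrix.of fun i j => if i = k ∧ (j : ℕ) = M - 1 then 1 else 0

noncomputable def Sh (M : ℕ) : Matrix (Fin M) (Fin M) ℝ :=
  Matrix.of fun i j => if (i : ℕ) = (j : ℕ) + 1 then 1 else 0

noncomputable def Fm (M : ℕ) : Matrix (Fin M) (Fin M) ℝ :=
  Matrix.of fun i j => if (i : ℕ) = 0 ∧ (j : ℕ) = M - 1 then 1 else 0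

lemma Sh_pow (M k : ℕ) : (Sh M) ^ k =
    Matrix.of fun i j : Fin M => if (i : ℕ) = (j : ℕ) + k then (1 : ℝ) else 0 := by
  induction k with
  | zero => ext i j; simp [Matrix.one_apply, Fin.ext_iff]
  | succ k ih =>
    rw [pow_succ, ih]
    ext i j
    simp only [Matrix.mul_apply, Matrix.of_apply, Sh]
    by_cases h : (i : ℕ) = j + (k + 1)
    · rw [if_pos h, Finset.sum_eq_single (⟨j + 1, by omega⟩ : Fin M)]
      · simp; omega
      · intro b _ hb
        rw [if_neg (c := (b : ℕ) = j + 1)]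
        · simp
        · intro h'; exact hb (Fin.ext h')
      · simp
    · rw [if_neg h]
      apply Finset.sum_eq_zero
      intro b _
      split_ifs <;> first | omega | simp

lemma Ek_eq (M : ℕ) (k : Fin M) : Ek M k = Sh M ^ (k : ℕ) * Fm M := by
  rw [Sh_pow]
  ext i j
  have h0 : 0 < M := i.pos
  simp only [Matrix.mul_apply, Matrix.of_apply, Fm, Ek]
  rw [Finset.sum_eq_single (⟨0, h0⟩ : Fin M)]
  · simp [Fin.ext_iff, ← ite_and, and_comm]
  · intro b _ hb
    rw [if_neg (c := (b : ℕ) = 0 ∧ _)]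
    · simp
    · rintro ⟨h', -⟩; exact hb (Fin.ext h')
  · simp

lemma kron_pow {m n : Type*} [Fintype m] [Fintype n] [DecidableEq m] [DecidableEq n]
    (X : Matrix m m ℝ) (Y : Matrix n n ℝ) (k : ℕ) : (X ⊗ₖ Y) ^ k = (X ^ k) ⊗ₖ (Y ^ k) := by
  induction k with
  | zero => simp
  | succ k ih => rw [pow_succ, ih, ← Matrix.mul_kronecker_mul, ← pow_succ, ← pow_succ]

lemma Q1_unit {N : ℕ} (A : Matrix (Fin N) (Fin N) ℝ)
    (hA : ∀ y : Fin N → ℝ, y ⬝ᵥ A.mulVec y ≤ 0) (τ : ℝ) (hτ : 0 < τ) :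
    IsUnit (1 - (τ / 2) • A) := by
  rw [← Matrix.mulVec_injective_iff_isUnit]
  intro x y hxy
  have h : (1 - (τ / 2) • A).mulVec (x - y) = 0 := by
    rw [Matrix.mulVec_sub, sub_eq_zero]; exact hxy
  have h2 : (x - y) ⬝ᵥ (1 - (τ / 2) • A).mulVec (x - y) = 0 := by rw [h]; simp
  rw [Matrix.sub_mulVec, Matrix.one_mulVec, Matrix.smul_mulVec, dotProduct_sub,
    dotProduct_smul, smul_eq_mul] at h2
  have h3 := hA (x - y)
  have h4 : 0 ≤ (x - y) ⬝ᵥ (x - y) := by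
    simp only [dotProduct]; exact Finset.sum_nonneg fun i _ => mul_self_nonneg _
  have h5 : (x - y) ⬝ᵥ (x - y) = 0 := by nlinarith
  exact sub_eq_zero.mp (dotProduct_self_eq_zero.mp h5)

/-- explicit form of 𝓜⁻¹P_α: it equals
I − α Σ_{k=1}^{M} E_{kM} ⊗ J_k, where J_k = (Q₁⁻¹Q₂)ᵏ. -/
theorem stmt_10 {N M : ℕ} (hN : 1 ≤ N) (hM : 1 ≤ M)
    (A : Matrix (Fin N) (Fin N) ℝ) (hA : ∀ y : Fin N → ℝ, y ⬝ᵥ A.mulVec y ≤ 0)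
    (τ : ℝ) (hτ : 0 < τ) (α : ℝ) (hα0 : 0 < α) (hα1 : α < 1)
    (𝓜 Pα : Matrix (Fin M × Fin N) (Fin M × Fin N) ℝ)
    (h𝓜 : 𝓜 = B1 M ⊗ₖ (1 : Matrix (Fin N) (Fin N) ℝ) - B2 M ⊗ₖ (τ • A))
    (hPα : Pα = C1 M α ⊗ₖ (1 : Matrix (Fin N) (Fin N) ℝ) - C2 M α ⊗ₖ (τ • A)) :
    𝓜⁻¹ * Pα =
      1 - α • ∑ k : Fin M,
        (Ek M k) ⊗ₖ (((1 - (τ / 2) • A)⁻¹ * (1 + (τ / 2) • A)) ^ ((k : ℕ) + 1)) := by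
  set Q1 := 1 - (τ / 2) • A with hQ1
  set Q2 := 1 + (τ / 2) • A with hQ2
  set J := Q1⁻¹ * Q2 with hJ
  have hu : IsUnit Q1 := Q1_unit A hA τ hτ
  have hQJ : Q1 * J = Q2 := by
    rw [hJ, ← Matrix.mul_assoc, Matrix.mul_nonsing_inv _ ((Matrix.isUnit_iff_isUnit_det _).mp hu),
      Matrix.one_mul]
  have hM1 : 𝓜 = ((1 : Matrix (Fin M) (Fin M) ℝ) ⊗ₖ Q1) * (1 - Sh M ⊗ₖ J) := by
    rw [mul_sub, mul_one, ← Matrix.mul_kronecker_mul, hQJ, one_mul, h𝓜]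
    ext ⟨i, a⟩ ⟨j, b⟩
    simp only [Matrix.sub_apply, Matrix.kroneckerMap_apply, B1, B2, Sh, Matrix.of_apply, hQ1, hQ2,
      Matrix.add_apply, Matrix.smul_apply, smul_eq_mul, Matrix.one_apply (i := i), Fin.ext_iff (a := i)]
    split_ifs <;> first | omega | ring
  have hP1 : Pα = 𝓜 - α • (Fm M ⊗ₖ Q2) := by
    rw [hPα, h𝓜]
    ext ⟨i, a⟩ ⟨j, b⟩
    simp only [Matrix.sub_apply, Matrix.kroneckerMap_apply, C1, C2, Fm, Matrix.of_apply, hQ2,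
      Matrix.add_apply, Matrix.smul_apply, smul_eq_mul]
    split_ifs <;> ring
  have hnil : (Sh M ⊗ₖ J) ^ M = 0 := by
    have : Sh M ^ M = 0 := by
      rw [Sh_pow]; ext i j
      have := i.isLt
      simp only [Matrix.of_apply, Matrix.zero_apply]
      rw [if_neg (by omega)]
    rw [kron_pow, this, Matrix.zero_kronecker]
  have hgeo : (1 - Sh M ⊗ₖ J) * ∑ k ∈ Finset.range M, (Sh M ⊗ₖ J) ^ k = 1 := by
    rw [mul_neg_geom_sum, hnil, sub_zero]
  have hsum : ∑ k : Fin M, (Ek M k) ⊗ₖ (J ^ ((k : ℕ) + 1)) =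
      (∑ k ∈ Finset.range M, (Sh M ⊗ₖ J) ^ k) * (Fm M ⊗ₖ J) := by
    rw [Finset.sum_mul, ← Fin.sum_univ_eq_sum_range (fun k => (Sh M ⊗ₖ J) ^ k * (Fm M ⊗ₖ J))]
    refine Finset.sum_congr rfl fun k _ => ?_
    rw [kron_pow, ← Matrix.mul_kronecker_mul, ← Ek_eq, pow_succ]
  have hMu : IsUnit 𝓜 := by
    rw [hM1]
    refine IsUnit.mul ?_ (IsNilpotent.isUnit_one_sub ⟨M, hnil⟩)
    refine IsUnit.of_mul_eq_one ((1 : Matrix (Fin M) (Fin M) ℝ) ⊗ₖ Q1⁻¹) ?_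
    rw [← Matrix.mul_kronecker_mul,
      Matrix.mul_nonsing_inv _ ((Matrix.isUnit_iff_isUnit_det _).mp hu)]
    simp
  have key : Pα = 𝓜 * (1 - α • ∑ k : Fin M, (Ek M k) ⊗ₖ (J ^ ((k : ℕ) + 1))) := by
    rw [mul_sub, mul_one, hP1, Matrix.mul_smul, hsum]
    congr 2
    rw [hM1, ← Matrix.mul_assoc, Matrix.mul_assoc _ (1 - _), hgeo, mul_one,
      ← Matrix.mul_kronecker_mul, hQJ, one_mul]
  rw [key, ← Matrix.mul_assoc, Matrix.nonsing_inv_mul _ ((Matrix.isUnit_iff_isUnit_det _).mp hMu),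
    Matrix.one_mul]
end

section
/- (Corollary, symmetric case.) Let A be an N×N real symmetric matrix that is negative semi-definite, τ > 0, α ∈ (0,1), M ≥ 1, and let 𝓜 = B₁ ⊗ I_N − B₂ ⊗ (τA) and P_α = C₁^{(α)} ⊗ I_N − C₂^{(α)} ⊗ (τA). Then P_α is invertible, (X − 1)^{(M−1)N} divides the characteristic polynomial of P_α⁻¹𝓜, and every eigenvalue of P_α⁻¹𝓜 (element of the spectrum of its complexification) is a real number lying in the interval [1/(1+α), 1/(1−α)]. -/
open Matrix Kronecker Polynomial

/-- The scalar M×M symbol. -/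
noncomputable def symB (M : ℕ) (x : ℝ) : Matrix (Fin M) (Fin M) ℝ :=
  B1 M - x • B2 M

/-- The scalar M×M preconditioner symbol. -/
noncomputable def symC (M : ℕ) (α x : ℝ) : Matrix (Fin M) (Fin M) ℝ :=
  C1 M α - x • C2 M α

lemma entry_zero (m : ℕ) (α x : ℝ) (s t : ℂ) (w : Fin (m+1) → ℂ) :
    ∑ j, (s * (symB (m+1) x 0 j : ℂ) + t * (symC (m+1) α x 0 j : ℂ)) * w j
      = (s + t) * (1 - x/2) * w 0 - t * α * (1 + x/2) * w (Fin.last m) := by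
  have h : ∀ j : Fin (m+1), (s * (symB (m+1) x 0 j : ℂ) + t * (symC (m+1) α x 0 j : ℂ)) * w j
      = (if j = 0 then (s + t) * (1 - x/2) * w j else 0)
        + (if j = Fin.last m then - (t * α * (1 + x/2) * w j) else 0) := by
    intro j
    have e1 : ((0:ℕ) = (j:ℕ)) ↔ j = 0 := by rw [Fin.ext_iff]; simp [eq_comm]
    have e2 : ((j:ℕ) = m) ↔ j = Fin.last m := by rw [Fin.ext_iff]; simp
    simp only [symB, symC, C1, C2, B1, B2, Matrix.sub_apply, Matrix.smul_apply, Matrix.of_apply,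
      Fin.val_zero, e1, smul_eq_mul, Nat.add_sub_cancel, e2, true_and]
    have e3 : ¬ ((0:ℕ) = (j:ℕ) + 1) := by omega
    simp only [e3, if_false]
    split_ifs <;> push_cast <;> ring
  rw [Finset.sum_congr rfl (fun j _ => h j), Finset.sum_add_distrib]
  simp only [Finset.sum_ite_eq', Finset.mem_univ, if_true]
  ring

lemma entry_succ (m : ℕ) (α x : ℝ) (s t : ℂ) (w : Fin (m+1) → ℂ) (k : Fin m) :
    ∑ j, (s * (symB (m+1) x k.succ j : ℂ) + t * (symC (m+1) α x k.succ j : ℂ)) * w j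
      = (s + t) * ((1 - x/2) * w k.succ - (1 + x/2) * w k.castSucc) := by
  have h : ∀ j : Fin (m+1), (s * (symB (m+1) x k.succ j : ℂ) + t * (symC (m+1) α x k.succ j : ℂ)) * w j
      = (if j = k.succ then (s + t) * (1 - x/2) * w j else 0)
        + (if j = k.castSucc then - ((s + t) * (1 + x/2) * w j) else 0) := by
    intro j
    have e1 : ((k:ℕ) + 1 = (j:ℕ)) ↔ j = k.succ := by rw [Fin.ext_iff]; simp [eq_comm]
    have e2 : ((k:ℕ) + 1 = (j:ℕ) + 1) ↔ j = k.castSucc := by rw [Fin.ext_iff]; simp [eq_comm]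
    have e3 : ¬ ((k:ℕ) + 1 = 0) := by omega
    simp only [symB, symC, C1, C2, B1, B2, Matrix.sub_apply, Matrix.smul_apply, Matrix.of_apply,
      Fin.val_succ, e1, smul_eq_mul, e2, e3, false_and, if_false]
    by_cases h1 : j = k.succ
    · have h2 : ¬ j = k.castSucc := by
        intro h2; rw [h1] at h2; simp [Fin.ext_iff] at h2
      simp only [h1, if_true]
      rw [if_neg (h1 ▸ h2)]; push_cast; ring
    · simp only [h1, if_false]
      split_ifs <;> push_cast <;> ring
  rw [Finset.sum_congr rfl (fun j _ => h j), Finset.sum_add_distrib]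
  simp only [Finset.sum_ite_eq', Finset.mem_univ, if_true]
  ring

lemma scalar_case (m : ℕ) (α x : ℝ) (hx : x ≤ 0) (s t : ℂ) (w : Fin (m+1) → ℂ) (hw : w ≠ 0)
    (h : ∀ k, ∑ j, (s * (symB (m+1) x k j : ℂ) + t * (symC (m+1) α x k j : ℂ)) * w j = 0) :
    s + t = 0 ∨ ∃ ρ : ℝ, |ρ| ≤ 1 ∧ s + t = t * α * ρ := by
  by_cases hst : s + t = 0
  · exact Or.inl hst
  right
  have hd : (0:ℝ) < 1 - x/2 := by linarith
  have hdc : (1 - x/2 : ℂ) ≠ 0 := by exact_mod_cast hd.ne'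
  set r : ℝ := (1 + x/2) / (1 - x/2) with hr
  have hrc : (r : ℂ) * (1 - x/2) = 1 + x/2 := by
    rw [hr]; push_cast; exact div_mul_cancel₀ _ hdc
  have hr1 : |r| ≤ 1 := by
    rw [abs_le, hr]
    constructor
    · rw [le_div_iff₀ hd]; linarith
    · rw [div_le_iff₀ hd]; linarith
  have hrec : ∀ k : Fin (m+1), w k = (r:ℂ)^(k:ℕ) * w 0 := by
    intro k
    induction k using Fin.induction with
    | zero => simp
    | succ k ih =>
      have := h k.succ
      rw [entry_succ] at this
      have := (mul_eq_zero.mp this).resolve_left hst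
      have h2 : (1 - x/2 : ℂ) * w k.succ = (1 - x/2 : ℂ) * (r * w k.castSucc) := by
        rw [← mul_assoc, mul_comm _ (r:ℂ), hrc]; exact sub_eq_zero.mp this
      rw [mul_left_cancel₀ hdc h2, ih]
      simp [pow_succ]; ring
  have hw0 : w 0 ≠ 0 := by
    intro h0; apply hw; funext k; rw [hrec k, h0]; simp
  refine ⟨r^(m+1), ?_, ?_⟩
  · rw [abs_pow]; exact pow_le_one₀ (abs_nonneg _) hr1
  · have := h 0
    rw [entry_zero, hrec (Fin.last m), ← hrc] at this
    have h3 : ((1 - x/2 : ℂ) * w 0) * ((s + t) - t * α * (r:ℂ)^(m+1)) = 0 := by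
      rw [← this, Fin.val_last]; ring
    have := (mul_eq_zero.mp h3).resolve_left (mul_ne_zero hdc hw0)
    push_cast
    exact sub_eq_zero.mp this

lemma diag_exists {N : ℕ} (A : Matrix (Fin N) (Fin N) ℝ) (hsym : A.IsSymm)
    (hA : ∀ y : Fin N → ℝ, y ⬝ᵥ A.mulVec y ≤ 0) :
    ∃ (U V : Matrix (Fin N) (Fin N) ℝ) (lam : Fin N → ℝ), U * V = 1 ∧
      V * A = diagonal lam * V ∧ ∀ i, lam i ≤ 0 := by
  have hH : A.IsHermitian := by
    rw [Matrix.IsHermitian, Matrix.conjTranspose_eq_transpose_of_trivial]; exact hsym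
  refine ⟨(hH.eigenvectorUnitary : Matrix _ _ ℝ), star (hH.eigenvectorUnitary : Matrix _ _ ℝ),
    hH.eigenvalues, ?_, ?_, ?_⟩
  · exact Unitary.coe_mul_star_self _
  · have h1 := hH.spectral_theorem
    have h2 := Unitary.coe_star_mul_self hH.eigenvectorUnitary
    rw [Unitary.conjStarAlgAut_apply] at h1
    have h3 := congrArg (fun Y => star (hH.eigenvectorUnitary : Matrix _ _ ℝ) * Y) h1
    refine h3.trans ?_
    rw [← Matrix.mul_assoc, ← Matrix.mul_assoc, h2, Matrix.one_mul]
    rfl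
  · intro i
    rw [hH.eigenvalues_eq]
    simpa using hA _

lemma kron_sum {M N : ℕ} (B : Matrix (Fin M) (Fin M) ℝ) (B' : Matrix (Fin M) (Fin M) ℝ)
    (A V : Matrix (Fin N) (Fin N) ℝ) (lam : Fin N → ℝ) (τ : ℝ)
    (h : V * A = diagonal lam * V) :
    ((1 : Matrix (Fin M) (Fin M) ℝ) ⊗ₖ V) *
      (B ⊗ₖ (1 : Matrix (Fin N) (Fin N) ℝ) - B' ⊗ₖ (τ • A)) =
    (B ⊗ₖ (1 : Matrix (Fin N) (Fin N) ℝ) - B' ⊗ₖ (τ • diagonal lam)) *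
      ((1 : Matrix (Fin M) (Fin M) ℝ) ⊗ₖ V) := by
  rw [Matrix.mul_sub, Matrix.sub_mul, ← Matrix.mul_kronecker_mul, ← Matrix.mul_kronecker_mul,
    ← Matrix.mul_kronecker_mul, ← Matrix.mul_kronecker_mul]
  simp [h]

lemma kdiag_apply {M N : ℕ} (B : Matrix (Fin M) (Fin M) ℝ) (B' : Matrix (Fin M) (Fin M) ℝ)
    (lam : Fin N → ℝ) (τ : ℝ) (w : Fin M × Fin N → ℂ) (k : Fin M) (i : Fin N) :
    (((B ⊗ₖ (1 : Matrix (Fin N) (Fin N) ℝ) - B' ⊗ₖ (τ • diagonal lam)).map (algebraMap ℝ ℂ)) *ᵥ w)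
      (k, i) = ∑ j, (((B - (τ * lam i) • B') k j : ℝ) : ℂ) * w (j, i) := by
  simp only [Matrix.mulVec, dotProduct, Fintype.sum_prod_type]
  refine Finset.sum_congr rfl fun j _ => ?_
  rw [Finset.sum_eq_single i]
  · simp only [Matrix.map_apply, Matrix.sub_apply, Matrix.kroneckerMap_apply, Matrix.smul_apply,
      Matrix.one_apply_eq, Matrix.diagonal_apply_eq, smul_eq_mul, Complex.coe_algebraMap]
    push_cast; ring
  · intro b _ hb
    simp [Matrix.kroneckerMap_apply, Matrix.one_apply_ne hb.symm, Matrix.diagonal_apply_ne _ hb.symm]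
  · simp

lemma pencil {N M : ℕ} (hM : 1 ≤ M)
    (A : Matrix (Fin N) (Fin N) ℝ) (hsym : A.IsSymm)
    (hA : ∀ y : Fin N → ℝ, y ⬝ᵥ A.mulVec y ≤ 0)
    (τ : ℝ) (hτ : 0 < τ) (α : ℝ)
    (𝓜 Pα : Matrix (Fin M × Fin N) (Fin M × Fin N) ℝ)
    (h𝓜 : 𝓜 = B1 M ⊗ₖ (1 : Matrix (Fin N) (Fin N) ℝ) - B2 M ⊗ₖ (τ • A))
    (hPα : Pα = C1 M α ⊗ₖ (1 : Matrix (Fin N) (Fin N) ℝ) - C2 M α ⊗ₖ (τ • A))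
    (s t : ℂ) (v : Fin M × Fin N → ℂ) (hv : v ≠ 0)
    (h : s • (𝓜.map (algebraMap ℝ ℂ) *ᵥ v) + t • (Pα.map (algebraMap ℝ ℂ) *ᵥ v) = 0) :
    s + t = 0 ∨ ∃ ρ : ℝ, |ρ| ≤ 1 ∧ s + t = t * α * ρ := by
  obtain ⟨U, V, lam, hUV, hVA, hlam⟩ := diag_exists A hsym hA
  obtain ⟨m, rfl⟩ : ∃ m, M = m + 1 := ⟨M - 1, by omega⟩
  set K : Matrix (Fin (m+1) × Fin N) (Fin (m+1) × Fin N) ℝ :=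
    (1 : Matrix (Fin (m+1)) (Fin (m+1)) ℝ) ⊗ₖ V with hK
  set w := K.map (algebraMap ℝ ℂ) *ᵥ v with hw
  have hwv : (((1 : Matrix (Fin (m+1)) (Fin (m+1)) ℝ) ⊗ₖ U).map (algebraMap ℝ ℂ)) *ᵥ w = v := by
    rw [hw, Matrix.mulVec_mulVec, ← Matrix.map_mul, hK, ← Matrix.mul_kronecker_mul, hUV]
    simp
  have hw0 : w ≠ 0 := by
    intro h0; apply hv; rw [← hwv, h0, Matrix.mulVec_zero]
  obtain ⟨⟨k0, i⟩, hki⟩ := Function.ne_iff.mp hw0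
  have h2 := congrArg (fun u => K.map (algebraMap ℝ ℂ) *ᵥ u) h
  simp only [Matrix.mulVec_add, Matrix.mulVec_smul, Matrix.mulVec_mulVec, ← Matrix.map_mul,
    Matrix.mulVec_zero] at h2
  rw [h𝓜, hPα, hK, kron_sum _ _ _ _ lam _ hVA, kron_sum _ _ _ _ lam _ hVA, ← hK,
    Matrix.map_mul, Matrix.map_mul, ← Matrix.mulVec_mulVec, ← Matrix.mulVec_mulVec, ← hw] at h2
  refine scalar_case m α (τ * lam i) (mul_nonpos_of_nonneg_of_nonpos hτ.le (hlam i)) s t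
    (fun j => w (j, i)) (fun h0 => hki (congrFun h0 k0)) ?_
  intro k
  have h3 := congrFun h2 (k, i)
  simp only [Pi.add_apply, Pi.smul_apply, kdiag_apply, smul_eq_mul, Pi.zero_apply] at h3
  rw [← h3, Finset.mul_sum, Finset.mul_sum, ← Finset.sum_add_distrib]
  refine Finset.sum_congr rfl fun j _ => ?_
  simp only [symB, symC]
  ring

lemma charpoly_dvd {N M : ℕ} (hM : 1 ≤ M)
    (Q : Matrix (Fin M × Fin N) (Fin M × Fin N) ℝ)
    (hQ : ∀ p q : Fin M × Fin N, (q.1 : ℕ) ≠ M - 1 → Q p q = (1 : Matrix _ _ ℝ) p q) :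
    (X - 1 : Polynomial ℝ) ^ ((M - 1) * N) ∣ Q.charpoly := by
  classical
  rw [Matrix.charpoly]
  rw [Matrix.twoBlockTriangular_det _ (fun q : Fin M × Fin N => (q.1 : ℕ) ≠ M - 1)]
  · refine Dvd.dvd.mul_right ?_ _
    have : (Q.charmatrix.toSquareBlockProp (fun q : Fin M × Fin N => (q.1 : ℕ) ≠ M - 1))
        = Matrix.scalar _ (X - 1 : Polynomial ℝ) := by
      ext1 ⟨p, hp⟩ ⟨q, hq⟩
      simp only [Matrix.toSquareBlockProp_def, Matrix.of_apply, Matrix.charmatrix_apply, hQ p q hq,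
        Matrix.scalar_apply, Matrix.diagonal_apply, Matrix.one_apply, Subtype.mk.injEq]
      split_ifs <;> simp
    rw [this, Matrix.scalar_apply, Matrix.det_diagonal, Finset.prod_const, Finset.card_univ]
    apply pow_dvd_pow
    obtain ⟨m, rfl⟩ : ∃ m, M = m + 1 := ⟨M - 1, by omega⟩
    have := Fintype.card_le_of_injective
      (fun q : Fin m × Fin N => (⟨(q.1.castSucc, q.2), by simp [q.1.2.ne]⟩ :
        {q : Fin (m+1) × Fin N // (q.1 : ℕ) ≠ m + 1 - 1})) (by
        intro a b hab
        simpa [Prod.ext_iff] using hab)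
    simpa using this
  · intro p hp q hq
    rw [Matrix.charmatrix_apply, hQ p q hq]
    have : p ≠ q := by rintro rfl; exact hp hq
    simp [this]

/-- Corollary, symmetric case: if moreover A is symmetric, then
every eigenvalue of P_α⁻¹𝓜 is real and lies in [1/(1+α), 1/(1−α)]. -/
theorem stmt_13 {N M : ℕ} (hN : 1 ≤ N) (hM : 1 ≤ M)
    (A : Matrix (Fin N) (Fin N) ℝ) (hsym : A.IsSymm)
    (hA : ∀ y : Fin N → ℝ, y ⬝ᵥ A.mulVec y ≤ 0)
    (τ : ℝ) (hτ : 0 < τ) (α : ℝ) (hα0 : 0 < α) (hα1 : α < 1)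
    (𝓜 Pα : Matrix (Fin M × Fin N) (Fin M × Fin N) ℝ)
    (h𝓜 : 𝓜 = B1 M ⊗ₖ (1 : Matrix (Fin N) (Fin N) ℝ) - B2 M ⊗ₖ (τ • A))
    (hPα : Pα = C1 M α ⊗ₖ (1 : Matrix (Fin N) (Fin N) ℝ) - C2 M α ⊗ₖ (τ • A)) :
    IsUnit Pα ∧
    (X - 1 : Polynomial ℝ) ^ ((M - 1) * N) ∣ (Pα⁻¹ * 𝓜).charpoly ∧
    ∀ z ∈ spectrum ℂ ((Pα⁻¹ * 𝓜).map (algebraMap ℝ ℂ)),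
      z.im = 0 ∧ 1 / (1 + α) ≤ z.re ∧ z.re ≤ 1 / (1 - α) := by
  have key := pencil hM A hsym hA τ hτ α 𝓜 Pα h𝓜 hPα
  have hU : IsUnit Pα := by
    rw [Matrix.isUnit_iff_isUnit_det, isUnit_iff_ne_zero]
    intro hdet
    have hdet' : (Pα.map (algebraMap ℝ ℂ)).det = 0 := by
      have := RingHom.map_det (algebraMap ℝ ℂ) Pα
      rw [hdet, map_zero] at this
      exact this.symm
    obtain ⟨v, hv, hPv⟩ := Matrix.exists_mulVec_eq_zero_iff.mpr hdet'
    rcases key 0 1 v hv (by rw [hPv]; simp) with h | ⟨ρ, hρ, h⟩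
    · simp at h
    · have h' : (1:ℝ) = α * ρ := by
        have : ((1:ℝ):ℂ) = ((α * ρ : ℝ) : ℂ) := by push_cast; simpa using h
        exact_mod_cast this
      have := (abs_le.mp hρ).2
      nlinarith
  have hdetU := (Matrix.isUnit_iff_isUnit_det _).mp hU
  refine ⟨hU, ?_, ?_⟩
  · apply charpoly_dvd hM
    intro p q hq
    have e : Pα⁻¹ * 𝓜 = 1 + Pα⁻¹ * (𝓜 - Pα) := by
      rw [Matrix.mul_sub, Matrix.nonsing_inv_mul _ hdetU]; abel
    rw [e, Matrix.add_apply, Matrix.mul_apply, Finset.sum_eq_zero, add_zero]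
    intro r _
    have : (𝓜 - Pα) r q = 0 := by
      rw [h𝓜, hPα]
      simp [Matrix.kroneckerMap_apply, C1, C2, hq]
    rw [this, mul_zero]
  · intro z hz
    have hz' : (Matrix.scalar (Fin M × Fin N) z - (Pα⁻¹ * 𝓜).map (algebraMap ℝ ℂ)).det = 0 := by
      rw [spectrum.mem_iff, Matrix.isUnit_iff_isUnit_det, isUnit_iff_ne_zero, not_not] at hz
      exact hz
    obtain ⟨v, hv, hzv⟩ := Matrix.exists_mulVec_eq_zero_iff.mpr hz'
    have hzv2 : (Pα⁻¹ * 𝓜).map (algebraMap ℝ ℂ) *ᵥ v = z • v := by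
      rw [Matrix.sub_mulVec, sub_eq_zero] at hzv
      rw [← hzv]
      ext i
      simp [Matrix.mulVec_diagonal]
    have h4 : 𝓜.map (algebraMap ℝ ℂ) *ᵥ v = z • (Pα.map (algebraMap ℝ ℂ) *ᵥ v) := by
      rw [← Matrix.mulVec_smul, ← hzv2, Matrix.mulVec_mulVec, ← Matrix.map_mul, ← Matrix.mul_assoc,
        Matrix.mul_nonsing_inv _ hdetU, Matrix.one_mul]
    have hz1 : ∃ ρ : ℝ, |ρ| ≤ 1 ∧ z * (1 - α * ρ) = 1 := by
      rcases key 1 (-z) v hv (by rw [h4]; simp) with h | ⟨ρ, hρ, h⟩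
      · refine ⟨0, by simp, ?_⟩
        push_cast; linear_combination -h
      · exact ⟨ρ, hρ, by linear_combination -h⟩
    obtain ⟨ρ, hρ, h5⟩ := hz1
    obtain ⟨h6, h7⟩ := abs_le.mp hρ
    have hpos : 0 < 1 - α * ρ := by nlinarith
    have hzeq : z = ((1 / (1 - α * ρ) : ℝ) : ℂ) := by
      have : (1 - α * ρ : ℂ) ≠ 0 := by exact_mod_cast hpos.ne'
      push_cast
      rw [eq_div_iff this, h5]
    rw [hzeq]
    refine ⟨Complex.ofReal_im _, ?_, ?_⟩
    · rw [Complex.ofReal_re]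
      apply one_div_le_one_div_of_le hpos
      nlinarith
    · rw [Complex.ofReal_re]
      apply one_div_le_one_div_of_le (by linarith)
      nlinarith
end

section
/- (Invertibility of the generalized block circulant preconditioner.) Let A be an N×N real matrix that is negative semi-definite and diagonalizable over ℂ, let τ > 0, M ≥ 1, and α ∈ (0,1). Then the preconditioner P_α = C₁^{(α)} ⊗ I_N − C₂^{(α)} ⊗ (τA) is an invertible matrix. -/
open Matrix Kronecker Polynomial

/-- weighted shift -/
noncomputable def shS (M : ℕ) (α : ℝ) (i j : Fin M) : ℝ :=
  (if (i : ℕ) = (j : ℕ) + 1 then 1 else 0) + (if (i : ℕ) = 0 ∧ (j : ℕ) = M - 1 then α else 0)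

lemma C1_eq (M : ℕ) (α : ℝ) (i j : Fin M) :
    C1 M α i j = (if i = j then 1 else 0) - shS M α i j := by
  simp only [C1, B1, shS, Matrix.of_apply, Fin.ext_iff]
  split_ifs <;> first | omega | ring

lemma C2_eq (M : ℕ) (α : ℝ) (i j : Fin M) :
    C2 M α i j = ((if i = j then 1 else 0) + shS M α i j) / 2 := by
  simp only [C2, B2, shS, Matrix.of_apply, Fin.ext_iff]
  split_ifs <;> first | omega | ring

lemma row_eq {N M : ℕ} (A : Matrix (Fin N) (Fin N) ℝ) (τ α : ℝ) (x : Fin M × Fin N → ℝ)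
    (k : Fin M) (i : Fin N) :
    ((C1 M α ⊗ₖ (1 : Matrix (Fin N) (Fin N) ℝ) - C2 M α ⊗ₖ (τ • A)) *ᵥ x) (k, i) =
      x (k, i) - (∑ j, shS M α k j * x (j, i))
        - τ / 2 * (A *ᵥ (fun l => x (k, l) + ∑ j, shS M α k j * x (j, l))) i := by
  have e1 : ∀ l, x (k, l) + ∑ j, shS M α k j * x (j, l)
      = ∑ j, ((if k = j then 1 else 0) + shS M α k j) * x (j, l) := by
    intro l; simp [add_mul, Finset.sum_add_distrib]
  have e2 : x (k, i) - (∑ j, shS M α k j * x (j, i))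
      = ∑ j, ((if k = j then 1 else 0) - shS M α k j) * x (j, i) := by
    simp [sub_mul, Finset.sum_sub_distrib]
  simp only [e1, e2]
  simp only [Matrix.mulVec, dotProduct, Fintype.sum_prod_type, Matrix.sub_apply,
    Matrix.kroneckerMap_apply, sub_mul, Finset.sum_sub_distrib, C2_eq, Matrix.smul_apply,
    smul_eq_mul, Finset.mul_sum]
  congr 1
  · rw [← Finset.sum_sub_distrib]
    refine Finset.sum_congr rfl fun j _ => ?_
    simp [C1_eq, Matrix.one_apply, sub_mul]
  · rw [Finset.sum_comm]
    refine Finset.sum_congr rfl fun j _ => Finset.sum_congr rfl fun l _ => ?_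
    ring

lemma energy {N : ℕ} (A : Matrix (Fin N) (Fin N) ℝ) (hA : ∀ y : Fin N → ℝ, y ⬝ᵥ A.mulVec y ≤ 0)
    (τ : ℝ) (hτ : 0 < τ) (u v : Fin N → ℝ)
    (h : ∀ i, u i - v i - τ / 2 * (A *ᵥ (fun l => u l + v l)) i = 0) :
    ∑ i, u i ^ 2 ≤ ∑ i, v i ^ 2 := by
  have h1 := hA (fun l => u l + v l)
  have h2 : ∑ i, u i ^ 2 - ∑ i, v i ^ 2
      = τ / 2 * ((fun l => u l + v l) ⬝ᵥ (A *ᵥ (fun l => u l + v l))) := by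
    rw [dotProduct, Finset.mul_sum, ← Finset.sum_sub_distrib]
    refine Finset.sum_congr rfl fun i _ => ?_
    linear_combination (u i + v i) * h i
  nlinarith

/-- invertibility of the generalized block circulant
preconditioner P_α = C₁^{(α)}⊗I − C₂^{(α)}⊗(τA). -/
theorem stmt_14 {N M : ℕ} (hN : 1 ≤ N) (hM : 1 ≤ M)
    (A : Matrix (Fin N) (Fin N) ℝ) (hA : ∀ y : Fin N → ℝ, y ⬝ᵥ A.mulVec y ≤ 0)
    (hdiag : ∃ P D : Matrix (Fin N) (Fin N) ℂ, IsUnit P ∧ D.IsDiag ∧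
      A.map (algebraMap ℝ ℂ) = P * D * P⁻¹)
    (τ : ℝ) (hτ : 0 < τ) (α : ℝ) (hα0 : 0 < α) (hα1 : α < 1) :
    IsUnit (C1 M α ⊗ₖ (1 : Matrix (Fin N) (Fin N) ℝ) - C2 M α ⊗ₖ (τ • A)) := by
  obtain ⟨m, rfl⟩ : ∃ m, M = m + 1 := ⟨M - 1, by omega⟩
  rw [← Matrix.mulVec_injective_iff_isUnit]
  rw [← Matrix.coe_mulVecLin, ← LinearMap.ker_eq_bot, LinearMap.ker_eq_bot']
  intro x hx
  rw [Matrix.mulVecLin_apply] at hx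
  have hE : ∀ k : Fin (m + 1), ∑ i, x (k, i) ^ 2
      ≤ ∑ i, (∑ j, shS (m + 1) α k j * x (j, i)) ^ 2 := by
    intro k
    refine energy A hA τ hτ (fun i => x (k, i)) (fun i => ∑ j, shS (m + 1) α k j * x (j, i)) ?_
    intro i
    have := congrFun hx (k, i)
    rw [row_eq] at this
    exact this
  have h0 : ∑ i, x (0, i) ^ 2 ≤ α ^ 2 * ∑ i, x (Fin.last m, i) ^ 2 := by
    refine (hE 0).trans_eq ?_
    rw [Finset.mul_sum]
    refine Finset.sum_congr rfl fun i _ => ?_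
    rw [Finset.sum_eq_single (Fin.last m)]
    · simp [shS]; ring
    · intro b _ hb
      have : (b : ℕ) ≠ m := fun h => hb (Fin.ext h)
      simp [shS, this]
    · simp
  have hs : ∀ k : ℕ, ∀ hk : k + 1 < m + 1, ∑ i, x (⟨k + 1, hk⟩, i) ^ 2
      ≤ ∑ i, x (⟨k, by omega⟩, i) ^ 2 := by
    intro k hk
    refine (hE _).trans_eq ?_
    refine Finset.sum_congr rfl fun i _ => ?_
    rw [Finset.sum_eq_single (⟨k, by omega⟩ : Fin (m + 1))]
    · simp [shS]
    · intro b _ hb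
      have : ¬ (k = (b : ℕ)) := fun h => hb (Fin.ext h.symm)
      simp [shS, this]
    · simp
  have hall : ∀ k : ℕ, ∀ hk : k < m + 1, ∑ i, x (⟨k, hk⟩, i) ^ 2 ≤ ∑ i, x (0, i) ^ 2 := by
    intro k
    induction k with
    | zero => intro hk; exact le_refl _
    | succ k ih => intro hk; exact (hs k hk).trans (ih _)
  have hl := hall m (by omega)
  have hnn : 0 ≤ ∑ i, x (0, i) ^ 2 := Finset.sum_nonneg fun i _ => sq_nonneg _
  have hz : ∑ i, x (0, i) ^ 2 ≤ 0 := by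
    have h3 : ∑ i, x (0, i) ^ 2 ≤ α ^ 2 * ∑ i, x (0, i) ^ 2 :=
      h0.trans (mul_le_mul_of_nonneg_left hl (sq_nonneg α))
    have h4 : 0 < 1 - α ^ 2 := by nlinarith
    by_contra hc
    push Not at hc
    nlinarith [mul_pos h4 hc]
  funext ⟨k, i⟩
  have h5 := (hall k k.2).trans hz
  have h6 := Finset.single_le_sum (f := fun i => x (k, i) ^ 2) (fun i _ => sq_nonneg _)
    (Finset.mem_univ i)
  have h7 : x (k, i) ^ 2 ≤ 0 := h6.trans h5
  exact pow_eq_zero_iff (two_ne_zero) |>.1 (le_antisymm h7 (sq_nonneg _))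
end

section
/- (Theorem 4.1, diagonalizability of the preconditioned matrix.) Let A be an N×N real matrix that is negative semi-definite and diagonalizable over ℂ, τ > 0, M ≥ 1, α ∈ (0,1), and let 𝓜 = B₁ ⊗ I_N − B₂ ⊗ (τA) and P_α = C₁^{(α)} ⊗ I_N − C₂^{(α)} ⊗ (τA). Then the complexification of P_α⁻¹𝓜 is diagonalizable: there exist an invertible complex MN×MN matrix S and a diagonal complex MN×MN matrix Υ such that P_α⁻¹𝓜 = S Υ S⁻¹ (as complex matrices). -/
open Matrix Kronecker Polynomial

theorem aux_re {N : ℕ}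
    (A : Matrix (Fin N) (Fin N) ℝ) (hA : ∀ y : Fin N → ℝ, y ⬝ᵥ A.mulVec y ≤ 0)
    (P : Matrix (Fin N) (Fin N) ℂ) (d : Fin N → ℂ) (hP : IsUnit P)
    (h : A.map (algebraMap ℝ ℂ) * P = P * diagonal d) (j : Fin N) : (d j).re ≤ 0 := by
  have hne : ∃ i, P i j ≠ 0 := by
    by_contra! hc
    have hdet : P.det = 0 := det_eq_zero_of_column_eq_zero j hc
    rw [Matrix.isUnit_iff_isUnit_det, hdet] at hP
    exact not_isUnit_zero hP
  have hcol : ∀ i, ∑ k, (A i k : ℂ) * P k j = P i j * d j := by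
    intro i
    have := congrFun (congrFun h i) j
    rw [Matrix.mul_diagonal] at this
    rw [← this, Matrix.mul_apply]
    simp
  have h1 := hA (fun i => (P i j).re)
  have h2 := hA (fun i => (P i j).im)
  have hr : ∀ i, A.mulVec (fun i => (P i j).re) i = (P i j).re * (d j).re - (P i j).im * (d j).im := by
    intro i
    have := congrArg Complex.re (hcol i)
    simpa [Matrix.mulVec, dotProduct] using this
  have hi : ∀ i, A.mulVec (fun i => (P i j).im) i = (P i j).re * (d j).im + (P i j).im * (d j).re := by
    intro i
    have := congrArg Complex.im (hcol i)
    simpa [Matrix.mulVec, dotProduct] using this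
  simp only [dotProduct, hr, hi] at h1 h2
  have h3 : (∑ i, ((P i j).re ^ 2 + (P i j).im ^ 2)) * (d j).re ≤ 0 := by
    have := add_nonpos h1 h2
    rw [← Finset.sum_add_distrib] at this
    rw [Finset.sum_mul]
    refine le_of_eq_of_le (Finset.sum_congr rfl fun i _ => ?_) this
    ring
  have h4 : 0 < ∑ i, ((P i j).re ^ 2 + (P i j).im ^ 2) := by
    obtain ⟨i, hi⟩ := hne
    refine Finset.sum_pos' (fun i _ => by positivity) ⟨i, Finset.mem_univ _, ?_⟩
    have := Complex.normSq_pos.2 hi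
    rw [Complex.normSq_apply] at this
    nlinarith
  by_contra! hc
  nlinarith [mul_pos h4 hc]

theorem aux_block {M : ℕ} (hM : 1 ≤ M) (α : ℝ) (hα0 : 0 < α) (hα1 : α < 1) (d : ℂ)
    (hd : d.re ≤ 0) (T Q : Matrix (Fin M) (Fin M) ℂ)
    (hT : T = (B1 M).map (algebraMap ℝ ℂ) - d • (B2 M).map (algebraMap ℝ ℂ))
    (hQ : Q = (C1 M α).map (algebraMap ℝ ℂ) - d • (C2 M α).map (algebraMap ℝ ℂ)) :
    ∃ (S : Matrix (Fin M) (Fin M) ℂ) (υ : Fin M → ℂ), IsUnit S ∧ IsUnit Q ∧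
      T * S = Q * S * diagonal υ := by
  obtain ⟨m, rfl⟩ : ∃ m, M = m + 1 := ⟨M - 1, by omega⟩
  set c : ℂ := 1 - d / 2 with hc
  set b : ℂ := 1 + d / 2 with hb
  have hTij : ∀ i j, T i j = (if (i : ℕ) = j then c else 0) - (if (i : ℕ) = (j : ℕ) + 1 then b else 0) := by
    intro i j
    rw [hT, hc, hb]
    simp only [B1, B2, Matrix.sub_apply, Matrix.map_apply, Matrix.of_apply, Matrix.smul_apply, smul_eq_mul]
    split_ifs <;> first | omega | (simp; try ring)
  have hQij : ∀ i j, Q i j = T i j - (if i = 0 ∧ j = Fin.last m then b * α else 0) := by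
    intro i j
    rw [hQ, hT, hb]
    simp only [C1, C2, Matrix.sub_apply, Matrix.map_apply, Matrix.of_apply, Matrix.smul_apply, smul_eq_mul, Fin.ext_iff,
      Fin.val_zero, Fin.val_last, Nat.add_sub_cancel]
    split_ifs <;> (simp; try ring)
  have hc0 : c ≠ 0 := by
    intro h
    have := congrArg Complex.re h
    simp [hc] at this
    linarith
  have hbc : ‖b‖ ≤ ‖c‖ := by
    rw [← sq_le_sq₀ (norm_nonneg _) (norm_nonneg _), ← Complex.normSq_eq_norm_sq,
      ← Complex.normSq_eq_norm_sq, Complex.normSq_apply, Complex.normSq_apply]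
    simp [hb, hc]
    nlinarith
  have hTu : IsUnit T := by
    rw [Matrix.isUnit_iff_isUnit_det, Matrix.det_of_lowerTriangular]
    · simp only [hTij]
      simp [hc0]
    · intro i j hij
      have : i < j := by simpa using hij
      rw [Fin.lt_def] at this
      rw [hTij, if_neg (by omega), if_neg (by omega), sub_zero]
  by_cases hb0 : b = 0
  · have : Q = T := by ext i j; rw [hQij, hb0]; simp
    refine ⟨1, 1, isUnit_one, this ▸ hTu, ?_⟩
    rw [this]; simp
  set r : ℂ := b / c with hr
  have hr0 : r ≠ 0 := div_ne_zero hb0 hc0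
  have hr1 : ‖r‖ ≤ 1 := by
    rw [hr, norm_div]
    exact div_le_one_of_le₀ hbc (norm_nonneg _)
  have hbr : b = c * r := by rw [hr]; field_simp
  have hden : 1 - α * r ^ (m + 1) ≠ 0 := by
    intro h
    have h1 : (1 : ℂ) = α * r ^ (m + 1) := sub_eq_zero.1 h
    have h2 := congrArg norm h1
    rw [norm_mul, norm_pow, norm_one, Complex.norm_real, Real.norm_of_nonneg hα0.le] at h2
    have h3 : ‖r‖ ^ (m + 1) ≤ 1 := pow_le_one₀ (norm_nonneg _) hr1
    nlinarith [norm_nonneg r]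
  set v : Fin (m + 1) → ℂ := fun k => r ^ (k : ℕ) with hv
  set S : Matrix (Fin (m + 1)) (Fin (m + 1)) ℂ := updateCol 1 (Fin.last m) v with hS
  have hSu : IsUnit S := by
    rw [Matrix.isUnit_iff_isUnit_det, hS, ← Matrix.cramer_apply, Matrix.cramer_one]
    simp [hv, hr0]
  have hTv : ∀ i, ∑ k, T i k * v k = if i = 0 then c else 0 := by
    intro i
    simp only [hTij, sub_mul, Finset.sum_sub_distrib, hv]
    refine Fin.cases ?_ (fun i => ?_) i
    · rw [Finset.sum_eq_single (0 : Fin (m+1)), Finset.sum_eq_zero]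
      · simp
      · intro k _; simp
      · intro k _ hk
        rw [if_neg, zero_mul]
        intro h; exact hk (Fin.ext h.symm)
      · simp
    · rw [Finset.sum_eq_single i.succ, Finset.sum_eq_single i.castSucc]
      · simp [hbr, pow_succ]; ring
      · intro k _ hk
        rw [if_neg, zero_mul]
        intro h; apply hk; ext; simp at h ⊢; omega
      · simp
      · intro k _ hk
        rw [if_neg, zero_mul]
        intro h; exact hk (Fin.ext h.symm)
      · simp
  set υ : Fin (m + 1) → ℂ := fun k => if k = Fin.last m then (1 - α * r ^ (m + 1))⁻¹ else 1 with hυ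
  have key : T * S = Q * S * diagonal υ := by
    ext i j
    rw [Matrix.mul_diagonal]
    by_cases hj : j = Fin.last m
    · subst hj
      have e1 : (T * S) i (Fin.last m) = if i = 0 then c else 0 := by
        rw [← hTv i, Matrix.mul_apply]; simp [hS]
      have e2 : (Q * S) i (Fin.last m) = if i = 0 then c * (1 - α * r ^ (m + 1)) else 0 := by
        have : (Q * S) i (Fin.last m) = (T * S) i (Fin.last m)
            - (if i = 0 then b * α * r ^ m else 0) := by
          rw [Matrix.mul_apply, Matrix.mul_apply]
          simp only [hQij, sub_mul, Finset.sum_sub_distrib]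
          congr 1
          rw [Finset.sum_eq_single (Fin.last m)]
          · by_cases hi : i = 0 <;> simp [hi, hS, hv]
          · intro k _ hk; simp [hk]
          · simp
        rw [this, e1, hbr]
        split_ifs
        · ring
        · ring
      rw [e1, e2]
      simp only [hυ, if_true]
      split_ifs
      · field_simp
      · simp
    · have e : ∀ X : Matrix (Fin (m + 1)) (Fin (m + 1)) ℂ, (X * S) i j = X i j := by
        intro X
        rw [Matrix.mul_apply]
        simp [hS, hj, Matrix.updateCol_apply, Matrix.one_apply]
      rw [e, e, hQij]
      simp [hυ, hj]
  refine ⟨S, υ, hSu, ?_, key⟩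
  have h1 := (hTu.mul hSu)
  rw [key, mul_assoc] at h1
  rw [Matrix.isUnit_iff_isUnit_det, Matrix.det_mul] at h1
  rw [Matrix.isUnit_iff_isUnit_det]
  exact isUnit_of_mul_isUnit_left h1

theorem aux_conj {N M : ℕ} (X Y : Matrix (Fin M) (Fin M) ℝ) (A : Matrix (Fin N) (Fin N) ℝ) (τ : ℝ)
    (P : Matrix (Fin N) (Fin N) ℂ) (d : Fin N → ℂ)
    (h : A.map (algebraMap ℝ ℂ) * P = P * diagonal d) :
    (X ⊗ₖ (1 : Matrix (Fin N) (Fin N) ℝ) - Y ⊗ₖ (τ • A)).map (algebraMap ℝ ℂ) *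
      ((1 : Matrix (Fin M) (Fin M) ℂ) ⊗ₖ P) =
    ((1 : Matrix (Fin M) (Fin M) ℂ) ⊗ₖ P) * blockDiagonal fun j =>
      X.map (algebraMap ℝ ℂ) - (τ * d j) • Y.map (algebraMap ℝ ℂ) := by
  have e1 : (X ⊗ₖ (1 : Matrix (Fin N) (Fin N) ℝ) - Y ⊗ₖ (τ • A)).map (algebraMap ℝ ℂ) =
      X.map (algebraMap ℝ ℂ) ⊗ₖ (1 : Matrix (Fin N) (Fin N) ℂ)
        - Y.map (algebraMap ℝ ℂ) ⊗ₖ ((τ : ℂ) • A.map (algebraMap ℝ ℂ)) := by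
    ext ⟨i, k⟩ ⟨j, l⟩
    simp [Matrix.one_apply, apply_ite]
  have e2 : (blockDiagonal fun j =>
      X.map (algebraMap ℝ ℂ) - (τ * d j) • Y.map (algebraMap ℝ ℂ)) =
      X.map (algebraMap ℝ ℂ) ⊗ₖ (1 : Matrix (Fin N) (Fin N) ℂ)
        - Y.map (algebraMap ℝ ℂ) ⊗ₖ ((τ : ℂ) • diagonal d) := by
    ext ⟨i, k⟩ ⟨j, l⟩
    by_cases hkl : k = l
    · subst hkl; simp [blockDiagonal_apply]; ring
    · simp [blockDiagonal_apply, hkl]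
  rw [e1, e2, sub_mul, mul_sub, ← mul_kronecker_mul, ← mul_kronecker_mul, ← mul_kronecker_mul,
    ← mul_kronecker_mul, smul_mul_assoc, mul_smul_comm, h]
  simp

/-- Theorem 4.1: the complexification of P_α⁻¹𝓜 is
diagonalizable: P_α⁻¹𝓜 = SΥS⁻¹ with S invertible and Υ diagonal (over ℂ). -/
theorem stmt_15 {N M : ℕ} (hN : 1 ≤ N) (hM : 1 ≤ M)
    (A : Matrix (Fin N) (Fin N) ℝ) (hA : ∀ y : Fin N → ℝ, y ⬝ᵥ A.mulVec y ≤ 0)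
    (hdiag : ∃ P D : Matrix (Fin N) (Fin N) ℂ, IsUnit P ∧ D.IsDiag ∧
      A.map (algebraMap ℝ ℂ) = P * D * P⁻¹)
    (τ : ℝ) (hτ : 0 < τ) (α : ℝ) (hα0 : 0 < α) (hα1 : α < 1)
    (𝓜 Pα : Matrix (Fin M × Fin N) (Fin M × Fin N) ℝ)
    (h𝓜 : 𝓜 = B1 M ⊗ₖ (1 : Matrix (Fin N) (Fin N) ℝ) - B2 M ⊗ₖ (τ • A))
    (hPα : Pα = C1 M α ⊗ₖ (1 : Matrix (Fin N) (Fin N) ℝ) - C2 M α ⊗ₖ (τ • A)) :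
    ∃ S Υ : Matrix (Fin M × Fin N) (Fin M × Fin N) ℂ,
      IsUnit S ∧ Υ.IsDiag ∧
      (Pα⁻¹ * 𝓜).map (algebraMap ℝ ℂ) = S * Υ * S⁻¹ := by
  obtain ⟨P, D, hP, hD, hPD⟩ := hdiag
  obtain ⟨d, rfl⟩ : ∃ d, D = diagonal d := ⟨_, hD.diagonal_diag.symm⟩
  have hPdet : IsUnit P.det := (Matrix.isUnit_iff_isUnit_det P).1 hP
  have h : A.map (algebraMap ℝ ℂ) * P = P * diagonal d := by
    rw [hPD, mul_assoc, Matrix.nonsing_inv_mul _ hPdet, mul_one]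
  have hre := aux_re A hA P d hP h
  have hre' : ∀ j, ((τ : ℂ) * d j).re ≤ 0 := by
    intro j
    rw [Complex.re_ofReal_mul]
    exact mul_nonpos_of_nonneg_of_nonpos hτ.le (hre j)
  have hb := fun j => aux_block hM α hα0 hα1 (τ * d j) (hre' j) _ _ rfl rfl
  choose S υ hS hQ hTS using hb
  have hm := aux_conj (B1 M) (B2 M) A τ P d h
  have hp := aux_conj (C1 M α) (C2 M α) A τ P d h
  rw [← h𝓜] at hm
  rw [← hPα] at hp
  set T := fun j => (B1 M).map (algebraMap ℝ ℂ) - ((τ : ℂ) * d j) • (B2 M).map (algebraMap ℝ ℂ)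
  set Q := fun j => (C1 M α).map (algebraMap ℝ ℂ) - ((τ : ℂ) * d j) • (C2 M α).map (algebraMap ℝ ℂ)
  set K : Matrix (Fin M × Fin N) (Fin M × Fin N) ℂ := (1 : Matrix (Fin M) (Fin M) ℂ) ⊗ₖ P
  have hunit : ∀ F : Fin N → Matrix (Fin M) (Fin M) ℂ, (∀ j, IsUnit (F j)) →
      IsUnit (blockDiagonal F) := by
    intro F hF
    rw [Matrix.isUnit_iff_isUnit_det, Matrix.det_blockDiagonal, isUnit_iff_ne_zero,
      Finset.prod_ne_zero_iff]
    intro j _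
    exact ((Matrix.isUnit_iff_isUnit_det _).1 (hF j)).ne_zero
  have hK : IsUnit K := by
    rw [Matrix.isUnit_iff_isUnit_det, Matrix.det_kronecker]
    simpa using hPdet.pow _
  have hQb : IsUnit (blockDiagonal Q) := hunit Q hQ
  have hSb : IsUnit (blockDiagonal S) := hunit S hS
  have hblk : blockDiagonal T * blockDiagonal S =
      blockDiagonal Q * blockDiagonal S * blockDiagonal (fun j => diagonal (υ j)) := by
    rw [← blockDiagonal_mul, ← blockDiagonal_mul, ← blockDiagonal_mul]
    congr 1
    funext j
    exact hTS j
  have hPc : IsUnit (Pα.map (algebraMap ℝ ℂ)) := by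
    have h1 := hK.mul hQb
    rw [← hp, Matrix.isUnit_iff_isUnit_det, Matrix.det_mul] at h1
    rw [Matrix.isUnit_iff_isUnit_det]
    exact isUnit_of_mul_isUnit_left h1
  have hPr : IsUnit Pα.det := by
    rw [Matrix.isUnit_iff_isUnit_det, ← RingHom.mapMatrix_apply, ← RingHom.map_det] at hPc
    rw [isUnit_iff_ne_zero] at hPc ⊢
    intro h0
    rw [h0] at hPc
    simp at hPc
  have hX : Pα.map (algebraMap ℝ ℂ) * (Pα⁻¹ * 𝓜).map (algebraMap ℝ ℂ) =
      𝓜.map (algebraMap ℝ ℂ) := by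
    rw [← Matrix.map_mul, Matrix.mul_nonsing_inv_cancel_left _ _ hPr]
  have hKS : IsUnit (K * blockDiagonal S) := hK.mul hSb
  refine ⟨K * blockDiagonal S, blockDiagonal (fun j => diagonal (υ j)), hKS, ?_, ?_⟩
  · rw [blockDiagonal_diagonal]
    exact isDiag_diagonal _
  · have hKSd := (Matrix.isUnit_iff_isUnit_det _).1 hKS
    have main : (Pα⁻¹ * 𝓜).map (algebraMap ℝ ℂ) * (K * blockDiagonal S) =
        K * blockDiagonal S * blockDiagonal (fun j => diagonal (υ j)) := by
      apply hPc.mul_left_cancel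
      rw [← mul_assoc, hX, ← mul_assoc, hm, mul_assoc, hblk, ← mul_assoc, ← mul_assoc, ← mul_assoc,
        ← mul_assoc, hp]
    rw [← main, Matrix.mul_nonsing_inv_cancel_right _ _ hKSd]
end

section
/- Let A be an N×N real symmetric negative semi-definite matrix, τ > 0, M ≥ 1, and let 𝓜 = B₁ ⊗ I_N − B₂ ⊗ (τA) and R = E_{1M} ⊗ Q₂, where Q₂ = I + (τ/2)A and E_{1M} is the M×M matrix with a single 1 in entry (1, M). Then 𝓜 is invertible and ‖𝓜⁻¹R‖₂ ≤ √M. -/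
open Matrix Kronecker Polynomial

/-- The M×M matrix with a single 1 in entry (1, M) (0-indexed: (0, M−1)). -/
noncomputable def E1M (M : ℕ) : Matrix (Fin M) (Fin M) ℝ :=
  Matrix.of fun i j => if (i : ℕ) = 0 ∧ (j : ℕ) = M - 1 then 1 else 0

theorem aux_energy {N : ℕ} (A : Matrix (Fin N) (Fin N) ℝ)
    (hA : ∀ y : Fin N → ℝ, y ⬝ᵥ A.mulVec y ≤ 0) (τ : ℝ) (hτ : 0 < τ) (u v : Fin N → ℝ)
    (h : ∀ a, u a - v a = (τ / 2) * (A *ᵥ u) a + (τ / 2) * (A *ᵥ v) a) :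
    u ⬝ᵥ u ≤ v ⬝ᵥ v := by
  have h1 : u - v = (τ / 2) • (A *ᵥ (u + v)) := by
    funext a
    simp only [Pi.sub_apply, Pi.smul_apply, Matrix.mulVec_add, Pi.add_apply, smul_eq_mul, h a]
    ring
  have h2 : (u + v) ⬝ᵥ (u - v) = (τ / 2) * ((u + v) ⬝ᵥ (A *ᵥ (u + v))) := by
    rw [h1, dotProduct_smul, smul_eq_mul]
  have h3 : (u + v) ⬝ᵥ (u - v) = u ⬝ᵥ u - v ⬝ᵥ v := by
    simp only [dotProduct_sub, add_dotProduct, dotProduct_comm v u]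
    ring
  have h4 := mul_nonneg hτ.le (neg_nonneg.2 (hA (u + v)))
  linarith

theorem aux_kron {m N : ℕ} (B : Matrix (Fin m) (Fin m) ℝ) (C : Matrix (Fin N) (Fin N) ℝ)
    (y : Fin m × Fin N → ℝ) (i : Fin m) (a : Fin N) :
    ((B ⊗ₖ C) *ᵥ y) (i, a) = ∑ j, B i j * (C *ᵥ (fun b => y (j, b))) a := by
  simp only [Matrix.mulVec, dotProduct, Fintype.sum_prod_type, Matrix.kroneckerMap_apply,
    Finset.mul_sum, mul_assoc]

theorem aux_bi_zero {m : ℕ} (a b : ℝ) (f : Fin (m+1) → ℝ) :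
    ∑ j : Fin (m+1), (if ((0 : Fin (m+1)) : ℕ) = (j : ℕ) then a
      else if ((0 : Fin (m+1)) : ℕ) = (j : ℕ) + 1 then b else 0) * f j = a * f 0 := by
  rw [Finset.sum_eq_single 0]
  · simp
  · intro j _ hj
    have : (0 : ℕ) ≠ j := fun h => hj (Fin.ext h.symm)
    simp [this]
  · simp

theorem aux_bi_succ {m : ℕ} (a b : ℝ) (f : Fin (m+1) → ℝ) (k : Fin m) :
    ∑ j : Fin (m+1), (if (k.succ : ℕ) = (j : ℕ) then a
      else if (k.succ : ℕ) = (j : ℕ) + 1 then b else 0) * f j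
      = a * f k.succ + b * f k.castSucc := by
  have : ∀ j : Fin (m+1), (if (k.succ : ℕ) = (j : ℕ) then a
      else if (k.succ : ℕ) = (j : ℕ) + 1 then b else 0) * f j
      = (if k.succ = j then a * f j else 0) + (if k.castSucc = j then b * f j else 0) := by
    intro j
    simp only [Fin.ext_iff, Fin.val_succ, Fin.val_castSucc]
    split_ifs <;> first | omega | simp
  rw [Finset.sum_congr rfl fun j _ => this j, Finset.sum_add_distrib]
  simp

theorem aux_main {N m : ℕ}
    (A : Matrix (Fin N) (Fin N) ℝ)
    (hA : ∀ y : Fin N → ℝ, y ⬝ᵥ A.mulVec y ≤ 0)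
    (τ : ℝ) (hτ : 0 < τ) (x y : Fin (m+1) × Fin N → ℝ)
    (h : (B1 (m+1) ⊗ₖ (1 : Matrix (Fin N) (Fin N) ℝ) - B2 (m+1) ⊗ₖ (τ • A)) *ᵥ y
      = (E1M (m+1) ⊗ₖ (1 + (τ / 2) • A)) *ᵥ x) :
    y ⬝ᵥ y ≤ ((m+1 : ℕ) : ℝ) * (x ⬝ᵥ x) := by
  set Y : Fin (m+1) → Fin N → ℝ := fun j b => y (j, b) with hY
  set X : Fin (m+1) → Fin N → ℝ := fun j b => x (j, b) with hX
  have key : ∀ i a, ∑ j, B1 (m+1) i j * Y j a - ∑ j, B2 (m+1) i j * (τ * (A *ᵥ Y j) a)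
      = ∑ j, E1M (m+1) i j * (X j a + (τ / 2) * (A *ᵥ X j) a) := by
    intro i a
    have := congrFun h (i, a)
    rw [Matrix.sub_mulVec, Pi.sub_apply, aux_kron, aux_kron, aux_kron] at this
    simpa [Matrix.add_mulVec, Matrix.smul_mulVec] using this
  have k0 : Y 0 ⬝ᵥ Y 0 ≤ X (Fin.last m) ⬝ᵥ X (Fin.last m) := by
    apply aux_energy A hA τ hτ
    intro a
    have := key 0 a
    simp only [B1, B2, Matrix.of_apply] at this
    rw [aux_bi_zero, aux_bi_zero, Finset.sum_eq_single (Fin.last m)] at this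
    · simp [E1M] at this
      linarith
    · intro j _ hj
      have : (j : ℕ) ≠ m := fun h => hj (Fin.ext h)
      simp [E1M, this]
    · simp
  have ks : ∀ k : Fin m, Y k.succ ⬝ᵥ Y k.succ ≤ Y k.castSucc ⬝ᵥ Y k.castSucc := by
    intro k
    apply aux_energy A hA τ hτ
    intro a
    have := key k.succ a
    simp only [B1, B2, Matrix.of_apply] at this
    rw [aux_bi_succ, aux_bi_succ] at this
    simp [E1M] at this
    linarith
  have kall : ∀ i, Y i ⬝ᵥ Y i ≤ X (Fin.last m) ⬝ᵥ X (Fin.last m) := by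
    intro i
    induction i using Fin.induction with
    | zero => exact k0
    | succ k ih => exact (ks k).trans ih
  have hy : y ⬝ᵥ y = ∑ i, Y i ⬝ᵥ Y i := by
    simp [dotProduct, Fintype.sum_prod_type, hY]
  have hx : x ⬝ᵥ x = ∑ i, X i ⬝ᵥ X i := by
    simp [dotProduct, Fintype.sum_prod_type, hX]
  have hl : X (Fin.last m) ⬝ᵥ X (Fin.last m) ≤ x ⬝ᵥ x := by
    rw [hx]
    exact Finset.single_le_sum (f := fun i => X i ⬝ᵥ X i)
      (fun i _ => Finset.sum_nonneg fun b _ => mul_self_nonneg _) (Finset.mem_univ _)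
  calc y ⬝ᵥ y ≤ ∑ i : Fin (m+1), x ⬝ᵥ x := by
        rw [hy]; exact Finset.sum_le_sum fun i _ => (kall i).trans hl
    _ = _ := by simp

/-- for A symmetric negative semi-definite, 𝓜 is invertible and
‖𝓜⁻¹R‖₂ ≤ √M, where R = E_{1M} ⊗ Q₂. -/
theorem stmt_16 {N M : ℕ} (hN : 1 ≤ N) (hM : 1 ≤ M)
    (A : Matrix (Fin N) (Fin N) ℝ) (hsym : A.IsSymm)
    (hA : ∀ y : Fin N → ℝ, y ⬝ᵥ A.mulVec y ≤ 0)
    (τ : ℝ) (hτ : 0 < τ)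
    (𝓜 R : Matrix (Fin M × Fin N) (Fin M × Fin N) ℝ)
    (h𝓜 : 𝓜 = B1 M ⊗ₖ (1 : Matrix (Fin N) (Fin N) ℝ) - B2 M ⊗ₖ (τ • A))
    (hR : R = E1M M ⊗ₖ (1 + (τ / 2) • A)) :
    IsUnit 𝓜 ∧ sNorm (𝓜⁻¹ * R) ≤ Real.sqrt M := by
  obtain ⟨m, rfl⟩ : ∃ m, M = m + 1 := ⟨M - 1, by omega⟩
  have main : ∀ x y, 𝓜 *ᵥ y = R *ᵥ x → y ⬝ᵥ y ≤ ((m+1 : ℕ) : ℝ) * (x ⬝ᵥ x) := by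
    intro x y h
    rw [h𝓜, hR] at h
    exact aux_main A hA τ hτ x y h
  have hu : IsUnit 𝓜 := by
    rw [← Matrix.mulVec_injective_iff_isUnit]
    intro u v huv
    have h0 := main 0 (u - v) (by
      have : 𝓜 *ᵥ u = 𝓜 *ᵥ v := huv
      simp [Matrix.mulVec_sub, this])
    simp only [dotProduct_zero, mul_zero] at h0
    have h1 : (u - v) ⬝ᵥ (u - v) = 0 :=
      le_antisymm h0 (Finset.sum_nonneg fun b _ => mul_self_nonneg _)
    exact sub_eq_zero.1 (dotProduct_self_eq_zero.1 h1)
  refine ⟨hu, ?_⟩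
  have hd : IsUnit 𝓜.det := (Matrix.isUnit_iff_isUnit_det _).1 hu
  unfold sNorm
  refine ContinuousLinearMap.opNorm_le_bound _ (Real.sqrt_nonneg _) fun x => ?_
  have h := main x.ofLp ((𝓜⁻¹ * R) *ᵥ x.ofLp) (by
    rw [Matrix.mulVec_mulVec, ← Matrix.mul_assoc, Matrix.mul_nonsing_inv _ hd, Matrix.one_mul])
  have hn : ∀ z : EuclideanSpace ℝ (Fin (m+1) × Fin N), ‖z‖ = √(z.ofLp ⬝ᵥ z.ofLp) := by
    intro z
    rw [EuclideanSpace.norm_eq]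
    congr 1
    exact Finset.sum_congr rfl fun i _ => by rw [Real.norm_eq_abs, sq_abs, sq]
  rw [hn, hn, ← Real.sqrt_mul (Nat.cast_nonneg _), Matrix.ofLp_toEuclideanCLM]
  exact Real.sqrt_le_sqrt h
end

section
/- Let A be an N×N real matrix that is negative semi-definite, τ > 0, M ≥ 1, α ∈ (0,1), and let 𝓜 = B₁ ⊗ I_N − B₂ ⊗ (τA), R = E_{1M} ⊗ Q₂ (so that P_α := 𝓜 − αR is the generalized block circulant preconditioner). Assume β := α‖𝓜⁻¹R‖₂ < 1/2. Then P_α is invertible and the following bounds hold: ‖P_α⁻¹𝓜‖₂ ≤ 1/(1 − β), ‖P_α⁻¹𝓜 − I‖₂ ≤ β/(1 − β), and the symmetric part H = ((P_α⁻¹𝓜) + (P_α⁻¹𝓜)ᵀ)/2 is positive definite with smallest eigenvalue λ_min(H) ≥ 1 − β/(1 − β) > 0. -/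
open Matrix Kronecker Polynomial

theorem calM_isUnit {N M : ℕ} (A : Matrix (Fin N) (Fin N) ℝ)
    (hA : ∀ y : Fin N → ℝ, y ⬝ᵥ A.mulVec y ≤ 0) (τ : ℝ) (hτ : 0 < τ) :
    IsUnit (B1 M ⊗ₖ (1 : Matrix (Fin N) (Fin N) ℝ) - B2 M ⊗ₖ (τ • A)) := by
  rw [← Matrix.mulVec_injective_iff_isUnit]
  refine (injective_iff_map_eq_zero (Matrix.mulVecLin _)).2 ?_
  intro v hv
  rw [Matrix.mulVecLin_apply] at hv
  have key : ∀ (n : ℕ) (hn : n < M) (a : Fin N), v (⟨n, hn⟩, a) = 0 := by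
    intro n
    induction n using Nat.strong_induction_on with
    | _ n ih =>
    intro hn
    set y : Fin N → ℝ := fun a => v (⟨n, hn⟩, a) with hy
    have hrow : ∀ a, y a - (τ / 2) * (A *ᵥ y) a = 0 := by
      intro a
      have h := congrFun hv (⟨n, hn⟩, a)
      simp only [Matrix.mulVec, dotProduct, Fintype.sum_prod_type, Pi.zero_apply] at h
      rw [Finset.sum_eq_single (⟨n, hn⟩ : Fin M)] at h
      · rw [← h]
        simp only [B1, B2, Matrix.sub_apply, Matrix.kroneckerMap_apply, Matrix.of_apply,
          Matrix.smul_apply, smul_eq_mul, if_true, sub_mul, Finset.sum_sub_distrib, one_mul,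
          Matrix.one_apply, ite_mul, zero_mul, Finset.sum_ite_eq, Finset.mem_univ,
          Matrix.mulVec, dotProduct, Finset.mul_sum]
        congr 1
        refine Finset.sum_congr rfl fun b _ => ?_
        simp only [hy]; ring
      · intro j _ hj
        refine Finset.sum_eq_zero fun b _ => ?_
        by_cases hjn : (j : ℕ) < n
        · rw [show v (j, b) = 0 from ih j hjn j.2 b, mul_zero]
        · have h1 : n ≠ (j : ℕ) := fun e => hj (Fin.ext e.symm)
          have h2 : n ≠ (j : ℕ) + 1 := by omega
          simp [B1, B2, Matrix.kroneckerMap_apply, h1, h2]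
      · simp
    have hyy : y ⬝ᵥ y = (τ / 2) * (y ⬝ᵥ A *ᵥ y) := by
      simp only [dotProduct, Finset.mul_sum]
      refine Finset.sum_congr rfl fun a _ => ?_
      linear_combination y a * hrow a
    have h0 : y ⬝ᵥ y = 0 := by
      refine le_antisymm ?_ (by simpa using dotProduct_star_self_nonneg y)
      rw [hyy]
      exact mul_nonpos_of_nonneg_of_nonpos (by positivity) (hA y)
    have := dotProduct_self_eq_zero.1 h0
    exact fun a => congrFun this a
  funext p
  exact key p.1 p.1.2 p.2

theorem posDef_of_lb {n : Type*} [Fintype n] [DecidableEq n] (H : Matrix n n ℝ)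
    (hs : Hᵀ = H) (c t : ℝ) (ht : t < c) (h : ∀ x : n → ℝ, c * (x ⬝ᵥ x) ≤ x ⬝ᵥ H *ᵥ x) :
    (H - t • (1 : Matrix n n ℝ)).PosDef := by
  refine Matrix.PosDef.of_dotProduct_mulVec_pos ?_ ?_
  · simp [Matrix.IsHermitian, Matrix.conjTranspose_eq_transpose_of_trivial, hs]
  · intro x hx
    have h1 : 0 < x ⬝ᵥ x := by
      have := dotProduct_star_self_pos_iff.2 hx
      simpa using this
    have := h x
    simp only [star_trivial, Matrix.sub_mulVec, Matrix.smul_mulVec, Matrix.one_mulVec,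
      dotProduct_sub, dotProduct_smul, smul_eq_mul]
    nlinarith

theorem sNorm_quad {n : Type*} [Fintype n] [DecidableEq n] (X : Matrix n n ℝ) (x : n → ℝ) :
    - (sNorm X * (x ⬝ᵥ x)) ≤ x ⬝ᵥ X *ᵥ x := by
  have h1 := abs_real_inner_le_norm (WithLp.toLp 2 x)
    (Matrix.toEuclideanCLM (𝕜 := ℝ) X (WithLp.toLp 2 x))
  have h2 := (Matrix.toEuclideanCLM (𝕜 := ℝ) X).le_opNorm (WithLp.toLp 2 x)
  have h3 : ‖WithLp.toLp 2 x‖ * ‖WithLp.toLp 2 x‖ = x ⬝ᵥ x := by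
    rw [← real_inner_self_eq_norm_mul_norm, EuclideanSpace.inner_toLp_toLp]; simp
  rw [Matrix.toEuclideanCLM_toLp] at h1 h2
  rw [EuclideanSpace.inner_toLp_toLp, star_trivial, dotProduct_comm] at h1
  have h4 := mul_le_mul_of_nonneg_left h2 (norm_nonneg (WithLp.toLp 2 x))
  have h5 := neg_abs_le (x ⬝ᵥ X *ᵥ x)
  have h6 : ‖WithLp.toLp 2 x‖ * (‖Matrix.toEuclideanCLM (𝕜 := ℝ) X‖ * ‖WithLp.toLp 2 x‖)
    = sNorm X * (x ⬝ᵥ x) := by rw [← h3, sNorm]; ring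
  linarith

theorem sNorm_mul_le {n : Type*} [Fintype n] [DecidableEq n] (X Y : Matrix n n ℝ) :
    sNorm (X * Y) ≤ sNorm X * sNorm Y := by
  unfold sNorm; rw [map_mul]; exact norm_mul_le _ _

theorem sNorm_add_le {n : Type*} [Fintype n] [DecidableEq n] (X Y : Matrix n n ℝ) :
    sNorm (X + Y) ≤ sNorm X + sNorm Y := by
  unfold sNorm; rw [map_add]; exact norm_add_le _ _

theorem sNorm_one_le {n : Type*} [Fintype n] [DecidableEq n] :
    sNorm (1 : Matrix n n ℝ) ≤ 1 := by
  unfold sNorm; rw [map_one]; exact ContinuousLinearMap.norm_id_le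

theorem isUnit_one_sub_of_sNorm {n : Type*} [Fintype n] [DecidableEq n] (Y : Matrix n n ℝ)
    (h : sNorm Y < 1) : IsUnit (1 - Y) := by
  have := isUnit_one_sub_of_norm_lt_one (x := Matrix.toEuclideanCLM (𝕜 := ℝ) Y) h
  rw [← map_one (Matrix.toEuclideanCLM (n := n) (𝕜 := ℝ)), ← map_sub] at this
  exact (MulEquiv.isUnit_map (Matrix.toEuclideanCLM (n := n) (𝕜 := ℝ))).1 this

/-- if β = α‖𝓜⁻¹R‖₂ < 1/2, then P_α = 𝓜 − αR is invertible,
‖P_α⁻¹𝓜‖₂ ≤ 1/(1−β), ‖P_α⁻¹𝓜 − I‖₂ ≤ β/(1−β), and the symmetric part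
H = (P_α⁻¹𝓜 + (P_α⁻¹𝓜)ᵀ)/2 is positive definite with
λ_min(H) ≥ 1 − β/(1−β) > 0. -/
theorem stmt_17 {N M : ℕ} (hN : 1 ≤ N) (hM : 1 ≤ M)
    (A : Matrix (Fin N) (Fin N) ℝ) (hA : ∀ y : Fin N → ℝ, y ⬝ᵥ A.mulVec y ≤ 0)
    (τ : ℝ) (hτ : 0 < τ) (α : ℝ) (hα0 : 0 < α) (hα1 : α < 1)
    (𝓜 R Pα H : Matrix (Fin M × Fin N) (Fin M × Fin N) ℝ)
    (h𝓜 : 𝓜 = B1 M ⊗ₖ (1 : Matrix (Fin N) (Fin N) ℝ) - B2 M ⊗ₖ (τ • A))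
    (hR : R = E1M M ⊗ₖ (1 + (τ / 2) • A))
    (hPα : Pα = 𝓜 - α • R)
    (hH : H = (1 / 2 : ℝ) • (Pα⁻¹ * 𝓜 + (Pα⁻¹ * 𝓜)ᵀ))
    (β : ℝ) (hβdef : β = α * sNorm (𝓜⁻¹ * R)) (hβ : β < 1 / 2) :
    IsUnit Pα ∧
    sNorm (Pα⁻¹ * 𝓜) ≤ 1 / (1 - β) ∧
    sNorm (Pα⁻¹ * 𝓜 - 1) ≤ β / (1 - β) ∧
    H.PosDef ∧
    (∀ μ ∈ spectrum ℝ H, 1 - β / (1 - β) ≤ μ) ∧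
    0 < 1 - β / (1 - β) := by
  have hMu : IsUnit 𝓜 := h𝓜 ▸ calM_isUnit A hA τ hτ
  have hMd := (Matrix.isUnit_iff_isUnit_det _).1 hMu
  obtain ⟨Y, hY⟩ : ∃ Y, Y = α • (𝓜⁻¹ * R) := ⟨_, rfl⟩
  have hYn : sNorm Y = β := by
    rw [hY, hβdef]; unfold sNorm
    rw [map_smul, norm_smul, Real.norm_of_nonneg hα0.le]
  have hβ0 : 0 ≤ β := by rw [← hYn]; exact norm_nonneg _
  have hP : Pα = 𝓜 * (1 - Y) := by
    rw [hPα, hY, mul_sub, mul_one, mul_smul_comm, Matrix.mul_nonsing_inv_cancel_left _ _ hMd]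
  have hU : IsUnit (1 - Y) := isUnit_one_sub_of_sNorm Y (by linarith)
  have hUd := (Matrix.isUnit_iff_isUnit_det _).1 hU
  have hPu : IsUnit Pα := hP ▸ hMu.mul hU
  obtain ⟨K, hK⟩ : ∃ K, K = Pα⁻¹ * 𝓜 := ⟨_, rfl⟩
  have hK' : K = (1 - Y)⁻¹ := by
    rw [hK, hP, Matrix.mul_inv_rev, mul_assoc, Matrix.nonsing_inv_mul _ hMd, mul_one]
  have hK1 : (1 - Y) * K = 1 := by rw [hK', Matrix.mul_nonsing_inv _ hUd]
  have hK2 : K = 1 + Y * K := by rw [← hK1]; noncomm_ring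
  have hb : 0 < 1 - β := by linarith
  have hn1 : sNorm K ≤ 1 / (1 - β) := by
    have h1 := sNorm_add_le 1 (Y * K)
    rw [← hK2] at h1
    have h2 := sNorm_mul_le Y K
    have h3 := sNorm_one_le (n := Fin M × Fin N)
    rw [hYn] at h2
    rw [le_div_iff₀ hb]; linarith
  have hn2 : sNorm (K - 1) ≤ β / (1 - β) := by
    have h1 : K - 1 = Y * K := by rw [sub_eq_iff_eq_add', ← hK2]
    rw [h1]
    refine (sNorm_mul_le Y K).trans ?_
    rw [hYn, div_eq_mul_one_div]
    exact mul_le_mul_of_nonneg_left hn1 hβ0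
  have hc : 0 < 1 - β / (1 - β) := by
    rw [sub_pos, div_lt_one hb]; linarith
  rw [← hK] at hH ⊢
  have hs : Hᵀ = H := by rw [hH]; simp [add_comm]
  have hq : ∀ x, (1 - β / (1 - β)) * (x ⬝ᵥ x) ≤ x ⬝ᵥ H *ᵥ x := by
    intro x
    have h1 := sNorm_quad (K - 1) x
    have h0 : 0 ≤ x ⬝ᵥ x := by simpa using dotProduct_star_self_nonneg x
    have h2 := mul_le_mul_of_nonneg_right hn2 h0
    have h3 : x ⬝ᵥ Kᵀ *ᵥ x = x ⬝ᵥ K *ᵥ x := by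
      rw [Matrix.mulVec_transpose, dotProduct_comm, ← Matrix.dotProduct_mulVec]
    rw [Matrix.sub_mulVec, dotProduct_sub, Matrix.one_mulVec] at h1
    rw [hH, Matrix.smul_mulVec, dotProduct_smul, Matrix.add_mulVec, dotProduct_add, h3,
      smul_eq_mul]
    linarith
  refine ⟨hPu, hn1, hn2, ?_, ?_, hc⟩
  · simpa using posDef_of_lb H hs _ 0 hc hq
  · intro μ hμ
    by_contra hlt
    push Not at hlt
    have := (posDef_of_lb H hs _ μ hlt hq).isUnit
    rw [spectrum.mem_iff, Algebra.algebraMap_eq_smul_one] at hμ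
    apply hμ
    rw [← neg_sub]; exact this.neg
end
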